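/- arXiv:math/0208107 — 2 statements merged into one kernel-verified Lean document; each statement's English description precedes it below -/
import Mathlib

section
/- Let V, Q be vector spaces of dimensions r and n−r, and 𝓘=(I^1,…,I^s) an s-tuple of subsets of [n], each of cardinality r. Let (𝓕,𝓖) be a generic point of Fl(V)^s × Fl(Q)^s and φ a generic element of Hom_𝓘(V,Q,𝓕,𝓖). Let S=ker(φ), d=dim(S), and 𝓚=(K^1,…,K^s) the unique s-tuple of subsets of [r], each of cardinality d, such that S ∈ ∩_{j=1}^{s} Ω°_{K^j}(F^j_•). Then dim Hom_𝓘(V,Q,𝓕,𝓖) = [dim(Gr(r,n)) − Σ_{j=1}^{s} codim(ω_{I^j})] + dim(S,V,𝓕) + [Σ_{j=1}^{s} Σ_{a∈K^j}(n−r+a−i^j_a) − d(n−r)]. -/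
noncomputable section

open Module Submodule

/-! ### Polynomial functions and the Zariski topology on a vector space -/

/-- Evaluation of a polynomial in linear functionals at a point of a vector space.
These are exactly the polynomial functions on a finite-dimensional vector space. -/
def mEval (k : Type*) {M : Type*} [Field k] [AddCommGroup M] [Module k M]
    (x : M) (p : MvPolynomial (Module.Dual k M) k) : k :=
  MvPolynomial.eval (fun l : Module.Dual k M => l x) p

/-- The Zariski topology on a (finite-dimensional) vector space, generated by the
complements of zero sets of polynomial functions. -/
def mZariski (k M : Type*) [Field k] [AddCommGroup M] [Module k M] :
    TopologicalSpace M :=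
  TopologicalSpace.generateFrom
    {U : Set M | ∃ p : MvPolynomial (Module.Dual k M) k, U = {x : M | mEval k x p ≠ 0}}

/-- The Zariski tangent space at a point `x` to a subset `A` of a vector space:
the common kernel of the differentials at `x` of all polynomial functions vanishing on `A`. -/
def mTangent (k : Type*) {M : Type*} [Field k] [AddCommGroup M] [Module k M]
    (A : Set M) (x : M) : Submodule k M :=
  letI := Classical.decEq (Module.Dual k M)
  ⨅ p ∈ {p : MvPolynomial (Module.Dual k M) k | ∀ a ∈ A, mEval k a p = 0},
    LinearMap.ker (∑ l ∈ p.vars, mEval k x (MvPolynomial.pderiv l p) • (l : Module.Dual k M))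

/-- `f : M → N` is a polynomial map on a subset `A ⊆ M`. -/
def IsPolyOn (k : Type*) {M N : Type*} [Field k] [AddCommGroup M] [Module k M]
    [AddCommGroup N] [Module k N] (A : Set M) (f : M → N) : Prop :=
  ∀ l : Module.Dual k N, ∃ p : MvPolynomial (Module.Dual k M) k, ∀ x ∈ A, l (f x) = mEval k x p

/-- Dimension (topological Krull dimension) of a subset of a topological space. -/
def subDim {α : Type*} (t : TopologicalSpace α) (C : Set α) : WithBot ℕ∞ :=
  @topologicalKrullDim C (TopologicalSpace.induced (Subtype.val : C → α) t)

/-- The irreducible components of a subset `A` of a topological space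
(for the subspace topology). -/
def subComponents {α : Type*} (t : TopologicalSpace α) (A : Set α) : Set (Set ↥A) :=
  @irreducibleComponents A (TopologicalSpace.induced (Subtype.val : A → α) t)

/-- Dimension of a subset `C` of a subspace `A` of a topological space. -/
def compDim {α : Type*} (t : TopologicalSpace α) (A : Set α) (C : Set ↥A) : WithBot ℕ∞ :=
  subDim (TopologicalSpace.induced (Subtype.val : A → α) t) C

/-! ### Flags, Schubert cells and Schubert varieties -/

/-- A complete flag on a finite-dimensional vector space, recorded as the increasing
function sending `m` to the `m`-th member (of dimension `m`) of the flag. -/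
def IsFlag {k M : Type*} [Field k] [AddCommGroup M] [Module k M]
    (E : ℕ → Submodule k M) : Prop :=
  Monotone E ∧ ∀ m : ℕ, finrank k ↥(E m) = min m (finrank k M)

/-- Membership of `V` in the (open) Schubert cell `Ω°_I(E_•) ⊆ Gr(r, M)` attached to the
subset `I ⊆ [n]` recorded by the strictly increasing tuple `i : Fin r → Fin n`
(`0`-indexed: the `1`-based subset is `{i a + 1}`): `dim (V ∩ E_u) = #{a | i_a ≤ u}`. -/
def cellMem {k M : Type*} [Field k] [AddCommGroup M] [Module k M] {n r : ℕ}
    (i : Fin r → Fin n) (E : ℕ → Submodule k M) (V : Submodule k M) : Prop :=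
  finrank k ↥V = r ∧
    ∀ u : ℕ, u ≤ n →
      finrank k ↥(V ⊓ E u) =
        (Finset.univ.filter (fun a : Fin r => (i a : ℕ) + 1 ≤ u)).card

/-- Membership of `V` in the (closed) Schubert variety `Ω_I(E_•) ⊆ Gr(r, M)`:
`dim (V ∩ E_{i_a}) ≥ a` for `a = 1, …, r`. -/
def varMem {k M : Type*} [Field k] [AddCommGroup M] [Module k M] {n r : ℕ}
    (i : Fin r → Fin n) (E : ℕ → Submodule k M) (V : Submodule k M) : Prop :=
  finrank k ↥V = r ∧ ∀ a : Fin r, (a : ℕ) + 1 ≤ finrank k ↥(V ⊓ E ((i a : ℕ) + 1))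

/-- The flag induced on a subspace `V` by a flag `E` on `M`: its `a`-th member is the
smallest subspace of the form `V ∩ E_u` of dimension `≥ a`. -/
def indSub {k M : Type*} [Field k] [AddCommGroup M] [Module k M]
    (E : ℕ → Submodule k M) (V : Submodule k M) : ℕ → Submodule k ↥V := fun a =>
  ⨅ u ∈ {u : ℕ | a ≤ finrank k ↥(Submodule.comap V.subtype (E u))},
    Submodule.comap V.subtype (E u)

/-- The flag induced on the quotient `M ⧸ V` by a flag `E` on `M`: its `b`-th member is
the smallest subspace of the form `(E_u + V)/V` of dimension `≥ b`. -/
def indQuot {k M : Type*} [Field k] [AddCommGroup M] [Module k M]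
    (E : ℕ → Submodule k M) (V : Submodule k M) : ℕ → Submodule k (M ⧸ V) := fun b =>
  ⨅ u ∈ {u : ℕ | b ≤ finrank k ↥(Submodule.map V.mkQ (E u))},
    Submodule.map V.mkQ (E u)

/-- The flag spanned by a tuple of vectors (a complete flag when the tuple is a basis). -/
def spanFlag (k : Type*) {M : Type*} [Field k] [AddCommGroup M] [Module k M] {r : ℕ}
    (b : Fin r → M) : ℕ → Submodule k M := fun m =>
  Submodule.span k (b '' {a : Fin r | (a : ℕ) < m})

/-- `P` holds for a generic point of `Fl(M)^s` (`r = dim M`): there is a nonempty Zariski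
open set of `s`-tuples of bases of `M` on which the associated tuples of complete flags
satisfy `P`. -/
def GenericFlags (k : Type*) {M : Type*} [Field k] [AddCommGroup M] [Module k M]
    (s r : ℕ) (P : (Fin s → ℕ → Submodule k M) → Prop) : Prop :=
  ∃ U : Set (Fin s → Fin r → M),
    @IsOpen _ (mZariski k (Fin s → Fin r → M)) U ∧
    (∃ b ∈ U, ∀ j, LinearIndependent k (b j)) ∧
    ∀ b ∈ U, (∀ j, LinearIndependent k (b j)) → P (fun j => spanFlag k (b j))

/-- `P` holds for a generic point of `Fl(M)^s × Fl(Q)^s` (`r = dim M`, `q = dim Q`). -/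
def GenericFlagPairs (k : Type*) {M Q : Type*} [Field k] [AddCommGroup M] [Module k M]
    [AddCommGroup Q] [Module k Q] (s r q : ℕ)
    (P : (Fin s → ℕ → Submodule k M) → (Fin s → ℕ → Submodule k Q) → Prop) : Prop :=
  ∃ U : Set ((Fin s → Fin r → M) × (Fin s → Fin q → Q)),
    @IsOpen _ (mZariski k ((Fin s → Fin r → M) × (Fin s → Fin q → Q))) U ∧
    (∃ b ∈ U, (∀ j, LinearIndependent k (b.1 j)) ∧ ∀ j, LinearIndependent k (b.2 j)) ∧
    ∀ b ∈ U, ((∀ j, LinearIndependent k (b.1 j)) ∧ ∀ j, LinearIndependent k (b.2 j)) →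
      P (fun j => spanFlag k (b.1 j)) (fun j => spanFlag k (b.2 j))

/-! ### The spaces `Hom_𝓘(V, Q, 𝓕, 𝓖)` -/

/-- The subspace `{φ : M →ₗ Q | φ(p) ⊆ q}` of `Hom(M, Q)`. -/
def homConstraint {k M Q : Type*} [Field k] [AddCommGroup M] [Module k M]
    [AddCommGroup Q] [Module k Q] (p : Submodule k M) (q : Submodule k Q) :
    Submodule k (M →ₗ[k] Q) :=
  LinearMap.ker ((LinearMap.llcomp k ↥p Q (Q ⧸ q) q.mkQ).comp (LinearMap.lcomp k Q p.subtype))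

/-- `Hom_𝓘(M, Q, F, G) = {φ | φ(F^j_a) ⊆ G^j_{i^j_a - a} for all a = 1, …, r, j = 1, …, s}`. -/
def homSpace {k M Q : Type*} [Field k] [AddCommGroup M] [Module k M]
    [AddCommGroup Q] [Module k Q] {n r s : ℕ} (I : Fin s → Fin r → Fin n)
    (F : Fin s → ℕ → Submodule k M) (G : Fin s → ℕ → Submodule k Q) :
    Submodule k (M →ₗ[k] Q) :=
  ⨅ j : Fin s, ⨅ a : Fin r,
    homConstraint (F j ((a : ℕ) + 1)) (G j ((I j a : ℕ) - (a : ℕ)))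

/-! ### Charts on the Grassmannian, tangent spaces to Schubert cells -/

/-- The graph of `ψ : V →ₗ C`, a point of the Grassmannian chart around `V`
determined by a complement `C` of `V`. -/
def graphMap {k M : Type*} [Field k] [AddCommGroup M] [Module k M]
    (V C : Submodule k M) (ψ : ↥V →ₗ[k] ↥C) : Submodule k M :=
  LinearMap.range (V.subtype + C.subtype ∘ₗ ψ)

/-- The canonical identification `Hom(V, C) ≃ Hom(V, M/V)` (derivative of the chart). -/
def conjMap {k M : Type*} [Field k] [AddCommGroup M] [Module k M]
    (V C : Submodule k M) : (↥V →ₗ[k] ↥C) →ₗ[k] (↥V →ₗ[k] M ⧸ V) :=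
  LinearMap.llcomp k ↥V ↥C (M ⧸ V) (V.mkQ ∘ₗ C.subtype)

/-- The tangent space at `V` to a set `S` of points of the Grassmannian `Gr(r, M)`,
computed in the chart determined by a complement `C` of `V` and viewed inside
`Hom(V, M/V)` via the canonical identification. -/
def grTangent {k M : Type*} [Field k] [AddCommGroup M] [Module k M]
    (S : Set (Submodule k M)) (V C : Submodule k M) :
    Submodule k (↥V →ₗ[k] (M ⧸ V)) :=
  Submodule.map (conjMap V C)
    (mTangent k {ψ : ↥V →ₗ[k] ↥C | graphMap V C ψ ∈ S} 0)

/-- The Zariski topology on the Grassmannian of `r`-dimensional subspaces of `M`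
(as a topology on `Submodule k M`), coinduced from the Stiefel parameterization by
spanning `r`-tuples. -/
def grTop (k : Type*) {M : Type*} [Field k] [AddCommGroup M] [Module k M] (r : ℕ) :
    TopologicalSpace (Submodule k M) :=
  TopologicalSpace.coinduced (fun b : Fin r → M => Submodule.span k (Set.range b))
    (mZariski k (Fin r → M))

/-! ### Numerical quantities -/

/-- `codim ω_I = ∑_{a=1}^r (n - r + a - i_a)` (as an integer). -/
def codimZ (n r : ℕ) (i : Fin r → Fin n) : ℤ :=
  ∑ a : Fin r, ((n : ℤ) - (r : ℤ) + ((a : ℕ) : ℤ) - ((i a : ℕ) : ℤ))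

/-- The quantity `∑_j ∑_{a ∈ K^j} (n - r + a - i^j_a) - d(n - r)` of Inequality `(†^𝓘_𝓚)`. -/
def daggerZ (n r d : ℕ) {s : ℕ} (I : Fin s → Fin r → Fin n)
    (K : Fin s → Fin d → Fin r) : ℤ :=
  (∑ j : Fin s, ∑ t : Fin d,
      ((n : ℤ) - (r : ℤ) + ((K j t : ℕ) : ℤ) - ((I j (K j t) : ℕ) : ℤ)))
    - (d : ℤ) * ((n : ℤ) - (r : ℤ))

/-- The expected dimension `dim(S, M, 𝓕) = d(m - d) - ∑_j ∑_{t=1}^d (m - d + t - k^j_t)`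
of an intersection of Schubert cells `Ω°_{K^j}` in `Gr(d, m)`. -/
def eDimZ {s : ℕ} (m d : ℕ) (K : Fin s → Fin d → Fin m) : ℤ :=
  (d : ℤ) * ((m : ℤ) - (d : ℤ)) -
    ∑ j : Fin s, ∑ t : Fin d,
      ((m : ℤ) - (d : ℤ) + ((t : ℕ) : ℤ) - ((K j t : ℕ) : ℤ))

/-- `codim ω_I` as a natural number. -/
def codimN (n r : ℕ) (i : Fin r → Fin n) : ℕ :=
  ∑ a : Fin r, ((n - r + (a : ℕ)) - (i a : ℕ))

/-! ### The cohomology ring of the Grassmannian, Schubert classes -/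

/-- The ideal `(h_{n-r+1}, …, h_n)` of the polynomial ring in `r` variables
(`h_m` the complete homogeneous symmetric polynomials). -/
def grassIdeal (r n : ℕ) : Ideal (MvPolynomial (Fin r) ℤ) :=
  Ideal.span ((fun m : ℕ => MvPolynomial.hsymm (Fin r) ℤ m) '' Set.Icc (n - r + 1) n)

/-- A presentation of the cohomology (Chow) ring `H^*(Gr(r,n))`: products of Schubert
classes vanish here exactly when they vanish in `H^*(Gr(r,n))`. -/
abbrev grassRing (r n : ℕ) : Type :=
  MvPolynomial (Fin r) ℤ ⧸ grassIdeal r n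

/-- `h_m` for an integer `m` (zero for negative `m`). -/
def hkZ (r : ℕ) (m : ℤ) : MvPolynomial (Fin r) ℤ :=
  if 0 ≤ m then MvPolynomial.hsymm (Fin r) ℤ m.toNat else 0

/-- The Schur polynomial (Jacobi–Trudi determinant) of the partition
`λ_a = n - r + a - i_a` attached to the subset `I ⊆ [n]` recorded by `i`. -/
def schurI {n r : ℕ} (i : Fin r → Fin n) : MvPolynomial (Fin r) ℤ :=
  Matrix.det (Matrix.of fun a b : Fin r =>
    hkZ r ((n : ℤ) - (r : ℤ) + ((b : ℕ) : ℤ) - ((i a : ℕ) : ℤ)))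

/-- The Schubert class `ω_I ∈ H^*(Gr(r,n))` of the subset `I ⊆ [n]` recorded by the
strictly increasing tuple `i : Fin r → Fin n`. -/
def omegaCls {n r : ℕ} (i : Fin r → Fin n) : grassRing r n :=
  Ideal.Quotient.mk (grassIdeal r n) (schurI i)

/-- The class of a point in `H^*(Gr(r,n))`: the Schubert class of `I = {1, …, r}`. -/
def pointCls (r n : ℕ) (h : r ≤ n) : grassRing r n :=
  omegaCls (fun a : Fin r => Fin.castLE h a)

/-! ### Schur polynomials of partitions, Littlewood–Richardson coefficients -/

/-- The Schur polynomial of a partition with at most `r` parts, via Jacobi–Trudi. -/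
def schurP {r : ℕ} (lam : Fin r → ℕ) : MvPolynomial (Fin r) ℤ :=
  Matrix.det (Matrix.of fun a b : Fin r =>
    hkZ r (((lam a : ℕ) : ℤ) - ((a : ℕ) : ℤ) + ((b : ℕ) : ℤ)))

/-- The Vandermonde alternant `a_δ = det(x_a^{r-1-b})`. -/
def alternant (r : ℕ) : MvPolynomial (Fin r) ℤ :=
  Matrix.det (Matrix.of fun a b : Fin r => (MvPolynomial.X a) ^ (r - 1 - (b : ℕ)))

/-- The coefficient of the Schur polynomial `s_δ` in a symmetric polynomial `f`
(in `r` variables): the coefficient of the monomial `x^{δ + (r-1, …, 1, 0)}` in `f ⬝ a_δ`. -/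
def schurCoeff (r : ℕ) (f : MvPolynomial (Fin r) ℤ) (δ : Fin r → ℕ) : ℤ :=
  MvPolynomial.coeff
    (Finsupp.equivFunOnFinite.symm (fun a : Fin r => δ a + (r - 1 - (a : ℕ))))
    (f * alternant r)

/-- The Littlewood–Richardson coefficient `c^λ_{μ,ν}` (partitions with at most `r` parts):
the multiplicity of `V_λ` in `V_μ ⊗ V_ν`, i.e. of `s_λ` in `s_μ s_ν`. -/
def lrCoeff (r : ℕ) (lam mu nu : Fin r → ℕ) : ℤ :=
  schurCoeff r (schurP mu * schurP nu) lam

/-- The multiplicity of `V_δ` in `V_{Λ 1} ⊗ ⋯ ⊗ V_{Λ t}` (as `GL(r)`-representations),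
i.e. of `s_δ` in `∏_j s_{Λ j}`. -/
def multiCoeff (r : ℕ) {t : ℕ} (Λ : Fin t → Fin r → ℕ) (δ : Fin r → ℕ) : ℤ :=
  schurCoeff r (∏ j : Fin t, schurP (Λ j)) δ

/-! ### Polynomial maps between finite-dimensional vector spaces -/

/-- The algebra of polynomial functions on a vector space. -/
def polyFun (k X : Type*) [Field k] [AddCommGroup X] [Module k X] : Subalgebra k (X → k) :=
  (MvPolynomial.aeval (R := k) (fun (l : Module.Dual k X) (x : X) => l x)).range

/-- A map between vector spaces all of whose coordinates are polynomial functions. -/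
def IsPolyMap (k : Type*) {X A : Type*} [Field k] [AddCommGroup X] [Module k X]
    [AddCommGroup A] [Module k A] (f : X → A) : Prop :=
  ∀ l : Module.Dual k A, (fun x => l (f x)) ∈ polyFun k X

section PolyMaps

variable {k X A B C : Type*} [Field k] [AddCommGroup X] [Module k X]
  [AddCommGroup A] [Module k A] [AddCommGroup B] [Module k B] [AddCommGroup C] [Module k C]

lemma mem_polyFun_iff {f : X → k} :
    f ∈ polyFun k X ↔ ∃ p : MvPolynomial (Module.Dual k X) k, ∀ x, f x = mEval k x p := by
  have key : ∀ (p : MvPolynomial (Module.Dual k X) k) (x : X),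
      MvPolynomial.aeval (R := k) (fun (l : Module.Dual k X) (x : X) => l x) p x
        = mEval k x p := by
    intro p x
    have h : (Pi.evalAlgHom k (fun _ : X => k) x).comp
        (MvPolynomial.aeval (R := k) (fun (l : Module.Dual k X) (x : X) => l x))
        = MvPolynomial.aeval (R := k) (fun l : Module.Dual k X => l x) := by
      ext l; simp
    have := DFunLike.congr_fun h p
    simpa [mEval, MvPolynomial.coe_aeval_eq_eval] using this
  constructor
  · rintro ⟨p, rfl⟩
    exact ⟨p, fun x => key p x⟩
  · rintro ⟨p, hp⟩
    exact ⟨p, funext fun x => (key p x).trans (hp x).symm⟩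

lemma isOpen_ne_zero_of_mem_polyFun {f : X → k} (hf : f ∈ polyFun k X) :
    @IsOpen _ (mZariski k X) {x | f x ≠ 0} := by
  obtain ⟨p, hp⟩ := mem_polyFun_iff.1 hf
  exact TopologicalSpace.isOpen_generateFrom_of_mem ⟨p, by simp only [hp]⟩

lemma dual_mem_polyFun (l : Module.Dual k X) : (fun x => l x) ∈ polyFun k X :=
  mem_polyFun_iff.2 ⟨MvPolynomial.X l, fun x => by simp [mEval]⟩

lemma const_mem_polyFun (c : k) : (fun _ : X => c) ∈ polyFun k X :=
  (polyFun k X).algebraMap_mem c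

lemma add_mem_polyFun {f g : X → k} (hf : f ∈ polyFun k X) (hg : g ∈ polyFun k X) :
    (fun x => f x + g x) ∈ polyFun k X :=
  (polyFun k X).add_mem hf hg

lemma mul_mem_polyFun {f g : X → k} (hf : f ∈ polyFun k X) (hg : g ∈ polyFun k X) :
    (fun x => f x * g x) ∈ polyFun k X :=
  (polyFun k X).mul_mem hf hg

lemma sum_mem_polyFun {ι : Type*} (s : Finset ι) {f : ι → X → k}
    (hf : ∀ i ∈ s, f i ∈ polyFun k X) : (fun x => ∑ i ∈ s, f i x) ∈ polyFun k X := by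
  have := (polyFun k X).sum_mem hf
  convert this using 1
  ext x; simp

lemma prod_mem_polyFun {ι : Type*} (s : Finset ι) {f : ι → X → k}
    (hf : ∀ i ∈ s, f i ∈ polyFun k X) : (fun x => ∏ i ∈ s, f i x) ∈ polyFun k X := by
  have := (polyFun k X).prod_mem hf
  convert this using 1
  ext x; simp

lemma det_mem_polyFun {ι : Type*} [Fintype ι] [DecidableEq ι] {D : X → Matrix ι ι k}
    (hD : ∀ i j, (fun x => D x i j) ∈ polyFun k X) : (fun x => (D x).det) ∈ polyFun k X := by
  simp only [Matrix.det_apply']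
  exact sum_mem_polyFun _ fun σ _ =>
    mul_mem_polyFun (const_mem_polyFun _) (prod_mem_polyFun _ fun i _ => hD _ _)

lemma adjugate_mem_polyFun {ι : Type*} [Fintype ι] [DecidableEq ι] {D : X → Matrix ι ι k}
    (hD : ∀ i j, (fun x => D x i j) ∈ polyFun k X) (i j : ι) :
    (fun x => (D x).adjugate i j) ∈ polyFun k X := by
  simp only [Matrix.adjugate_apply]
  refine det_mem_polyFun fun a b => ?_
  by_cases h : a = j
  · subst h
    simpa using const_mem_polyFun _
  · simpa [Matrix.updateRow_ne h] using hD a b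

lemma comp_line_mem_polyFun {f : X → k} (hf : f ∈ polyFun k X) (x y : X) :
    ∃ p : Polynomial k, ∀ t, f (x + t • y) = p.eval t := by
  obtain ⟨p, hp⟩ := mem_polyFun_iff.1 hf
  refine ⟨MvPolynomial.aeval (R := k) (fun l : Module.Dual k X =>
    Polynomial.C (l x) + Polynomial.X * Polynomial.C (l y)) p, fun t => ?_⟩
  have h : (Polynomial.aeval (R := k) t).comp (MvPolynomial.aeval (R := k)
      (fun l : Module.Dual k X => Polynomial.C (l x) + Polynomial.X * Polynomial.C (l y)))
      = MvPolynomial.aeval (R := k) (fun l : Module.Dual k X => l (x + t • y)) := by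
    ext l
    simp
    ring
  have := DFunLike.congr_fun h p
  rw [hp]
  simpa [mEval, MvPolynomial.coe_aeval_eq_eval, Polynomial.coe_aeval_eq_eval] using this.symm

lemma eval_mem_polyFun (p : Polynomial k) : (fun t : k => p.eval t) ∈ polyFun k k := by
  simp only [Polynomial.eval_eq_sum_range]
  exact sum_mem_polyFun _ fun i _ => mul_mem_polyFun (const_mem_polyFun _)
    ((polyFun k k).pow_mem (dual_mem_polyFun (LinearMap.id : k →ₗ[k] k)) i)

lemma polyFun_comp_line {f : X → k} (hf : f ∈ polyFun k X) (x y : X) :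
    (fun t : k => f (x + t • y)) ∈ polyFun k k := by
  obtain ⟨p, hp⟩ := comp_line_mem_polyFun hf x y
  simpa only [hp] using eval_mem_polyFun p

/-- Over an infinite field, two nonzero polynomial functions have a common nonvanishing point. -/
lemma exists_ne_zero_of_mem_polyFun [Infinite k] {f g : X → k}
    (hf : f ∈ polyFun k X) (hg : g ∈ polyFun k X) {x y : X} (hx : f x ≠ 0) (hy : g y ≠ 0) :
    ∃ z, f z ≠ 0 ∧ g z ≠ 0 := by
  obtain ⟨p, hp⟩ := comp_line_mem_polyFun hf x (y - x)
  obtain ⟨q, hq⟩ := comp_line_mem_polyFun hg x (y - x)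
  have hp0 : p ≠ 0 := by
    rintro rfl
    exact hx (by simpa using hp 0)
  have hq0 : q ≠ 0 := by
    rintro rfl
    exact hy (by simpa using hq 1)
  by_contra! h
  refine mul_ne_zero hp0 hq0 (Polynomial.funext fun t => ?_)
  by_cases h0 : f (x + t • (y - x)) = 0
  · simp [← hp, h0]
  · simp [← hq, h _ h0]

lemma polyFun_eq_zero [Infinite k] {f g : X → k}
    (hf : f ∈ polyFun k X) (hg : g ∈ polyFun k X) {y : X} (hy : g y ≠ 0)
    (h : ∀ x, g x ≠ 0 → f x = 0) (x : X) : f x = 0 := by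
  by_contra hx
  obtain ⟨z, hz, hz'⟩ := exists_ne_zero_of_mem_polyFun hf hg hx hy
  exact hz (h z hz')

namespace IsPolyMap

lemma linear (L : X →ₗ[k] A) : IsPolyMap k (fun x => L x) :=
  fun l => dual_mem_polyFun (l ∘ₗ L)

lemma const (a : A) : IsPolyMap k (fun _ : X => a) := fun _ => const_mem_polyFun _

lemma of_mem {f : X → k} (hf : f ∈ polyFun k X) : IsPolyMap k f := by
  intro l
  have : (fun x => l (f x)) = fun x => f x * l 1 := by
    ext x
    rw [← smul_eq_mul, ← map_smul, smul_eq_mul, mul_one]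
  rw [this]
  exact mul_mem_polyFun hf (const_mem_polyFun _)

lemma add {f g : X → A} (hf : IsPolyMap k f) (hg : IsPolyMap k g) :
    IsPolyMap k (fun x => f x + g x) := fun l => by
  simpa only [map_add] using add_mem_polyFun (hf l) (hg l)

lemma comp_linear {f : X → A} (hf : IsPolyMap k f) (L : A →ₗ[k] B) :
    IsPolyMap k (fun x => L (f x)) := fun l => hf (l ∘ₗ L)

lemma comp_line {f : X → A} (hf : IsPolyMap k f) (x y : X) :
    IsPolyMap k (fun t : k => f (x + t • y)) := fun l => polyFun_comp_line (hf l) x y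

lemma bilin [FiniteDimensional k A] (β : A →ₗ[k] B →ₗ[k] C) {f : X → A} {g : X → B}
    (hf : IsPolyMap k f) (hg : IsPolyMap k g) : IsPolyMap k (fun x => β (f x) (g x)) := by
  intro l
  have h : (fun x => l (β (f x) (g x)))
      = fun x => ∑ i, (finBasis k A).coord i (f x) * l (β (finBasis k A i) (g x)) := by
    ext x
    conv_lhs => rw [← (finBasis k A).sum_repr (f x)]
    simp only [map_sum, map_smul, LinearMap.sum_apply, LinearMap.smul_apply, smul_eq_mul,
      Basis.coord_apply]
  rw [h]
  exact sum_mem_polyFun _ fun i _ =>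
    mul_mem_polyFun (hf _) ((hg.comp_linear (β (finBasis k A i))) l)

lemma smul {c : X → k} {f : X → A} (hc : c ∈ polyFun k X) (hf : IsPolyMap k f) :
    IsPolyMap k (fun x => c x • f x) :=
  bilin (LinearMap.lsmul k A) (of_mem hc) hf

lemma apply [FiniteDimensional k A] [FiniteDimensional k B] {M : X → A →ₗ[k] B} {f : X → A}
    (hM : IsPolyMap k M) (hf : IsPolyMap k f) : IsPolyMap k (fun x => M x (f x)) :=
  bilin LinearMap.id hM hf

lemma pi {ι : Type*} [Fintype ι] [DecidableEq ι] {f : X → ι → A}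
    (hf : ∀ i, IsPolyMap k (fun x => f x i)) : IsPolyMap k f := by
  intro l
  have h : (fun x => l (f x)) = fun x => ∑ i, (l ∘ₗ LinearMap.single k (fun _ => A) i) (f x i) := by
    ext x
    simp only [LinearMap.comp_apply, ← map_sum]
    congr 1
    exact (Finset.univ_sum_single (f x)).symm
  rw [h]
  exact sum_mem_polyFun _ fun i _ => hf i _

/-- First-order Taylor expansion of a polynomial curve. -/
lemma exists_taylor [FiniteDimensional k A] {w : k → A} (hw : IsPolyMap k w) :
    ∃ (a : A) (g : k → A), IsPolyMap k g ∧ ∀ t, w t = w 0 + t • a + t ^ 2 • g t := by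
  have h1 : ∀ i, ∃ p : Polynomial k, ∀ t, (finBasis k A).coord i (w t) = p.eval t := by
    intro i
    obtain ⟨p, hp⟩ := comp_line_mem_polyFun (hw ((finBasis k A).coord i)) 0 1
    exact ⟨p, fun t => by simpa using hp t⟩
  choose p hp using h1
  refine ⟨∑ i, (p i).divX.eval 0 • finBasis k A i,
    fun t => ∑ i, (p i).divX.divX.eval t • finBasis k A i, ?_, fun t => ?_⟩
  · intro l
    simp only [map_sum, map_smul, smul_eq_mul]
    exact sum_mem_polyFun _ fun i _ =>
      mul_mem_polyFun (eval_mem_polyFun _) (const_mem_polyFun _)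
  · refine (finBasis k A).ext_elem fun i => ?_
    have e1 : ∀ (P : Polynomial k) (t : k), P.eval t = P.eval 0 + t * P.divX.eval t := by
      intro P t
      conv_lhs => rw [← Polynomial.divX_mul_X_add P]
      simp [Polynomial.coeff_zero_eq_eval_zero]
      ring
    have e2 := hp i t
    have e3 := hp i 0
    simp only [Basis.coord_apply] at e2 e3
    simp only [map_add, map_smul, map_sum, Basis.repr_self, Finsupp.coe_add, Finsupp.coe_smul,
      Pi.add_apply, Pi.smul_apply, Finsupp.finsetSum_apply, Finsupp.single_apply, smul_eq_mul,
      mul_ite, mul_one, mul_zero, Finset.sum_ite_eq', Finset.mem_univ, if_true, e2, e3]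
    rw [e1 (p i) t, e1 (p i).divX t]
    ring

end IsPolyMap

/-- If a bilinear expression in two polynomial curves vanishes identically, then so does its
derivative at the origin. -/
lemma bilin_deriv_eq_zero [Infinite k] [FiniteDimensional k A] [FiniteDimensional k B]
    (β : A →ₗ[k] B →ₗ[k] C) {v g : k → A} {w h : k → B} {v1 : A} {w1 : B}
    (hg : IsPolyMap k g) (hh : IsPolyMap k h)
    (hv : ∀ t, v t = v 0 + t • v1 + t ^ 2 • g t) (hw : ∀ t, w t = w 0 + t • w1 + t ^ 2 • h t)
    (h0 : ∀ t, β (v t) (w t) = 0) : β v1 (w 0) + β (v 0) w1 = 0 := by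
  have hid : (fun t : k => t) ∈ polyFun k k := dual_mem_polyFun (LinearMap.id : k →ₗ[k] k)
  have hid2 : (fun t : k => t ^ 2) ∈ polyFun k k := (polyFun k k).pow_mem hid 2
  set G : k → C := fun t => β v1 w1 + β (g t) (w 0 + t • w1 + t ^ 2 • h t)
    + β (v 0 + t • v1) (h t) with hG
  have hGp : IsPolyMap k G := by
    have l1 : IsPolyMap k (fun t : k => w 0 + t • w1 + t ^ 2 • h t) :=
      ((IsPolyMap.const _).add (.smul hid (.const _))).add (.smul hid2 hh)
    have l2 : IsPolyMap k (fun t : k => v 0 + t • v1) :=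
      (IsPolyMap.const _).add (.smul hid (.const _))
    exact ((IsPolyMap.const _).add (.bilin β hg l1)).add (.bilin β l2 hh)
  have key : ∀ t, β (v 0) (w 0) + t • (β v1 (w 0) + β (v 0) w1) + t ^ 2 • G t = 0 := by
    intro t
    rw [← h0 t, hv t, hw t, hG]
    simp only [map_add, map_smul, LinearMap.add_apply, LinearMap.smul_apply, smul_add, smul_smul]
    module
  have h00 : β (v 0) (w 0) = 0 := by simpa using key 0
  rw [← Module.forall_dual_apply_eq_zero_iff k]
  intro l
  have hf : (fun t : k => l (β v1 (w 0) + β (v 0) w1) + t * l (G t)) ∈ polyFun k k :=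
    add_mem_polyFun (const_mem_polyFun _) (mul_mem_polyFun hid (hGp l))
  have := polyFun_eq_zero hf hid (y := (1 : k)) one_ne_zero (fun t ht => by
    have e := congrArg l (key t)
    rw [h00] at e
    simp only [zero_add, map_add, map_smul, smul_eq_mul, map_zero] at e
    apply mul_left_cancel₀ ht
    rw [mul_zero, map_add]
    linear_combination e) 0
  simpa using this

end PolyMaps

/-! ### Polynomial families of linear maps -/

section Families

variable {k X A B : Type*} [Field k] [AddCommGroup X] [Module k X]
  [AddCommGroup A] [Module k A] [AddCommGroup B] [Module k B]

lemma LinearMap.exists_frame [FiniteDimensional k B] (T : A →ₗ[k] B) :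
    ∃ (P : B →ₗ[k] (Fin (finrank k (LinearMap.range T)) → k))
      (S : (Fin (finrank k (LinearMap.range T)) → k) →ₗ[k] A), P ∘ₗ T ∘ₗ S = LinearMap.id := by
  obtain ⟨p, hp⟩ := LinearMap.exists_leftInverse_of_injective (LinearMap.range T).subtype
    (by simp)
  obtain ⟨q, hq⟩ := LinearMap.exists_rightInverse_of_surjective T.rangeRestrict
    (LinearMap.range_rangeRestrict T)
  let e := (finBasis k (LinearMap.range T)).equivFun
  refine ⟨e.toLinearMap ∘ₗ p, q ∘ₗ e.symm.toLinearMap, LinearMap.ext fun y => ?_⟩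
  have h1 : T (q (e.symm y)) = ((e.symm y : LinearMap.range T) : B) :=
    congrArg Subtype.val (LinearMap.congr_fun hq (e.symm y))
  have h2 : p ((e.symm y : LinearMap.range T) : B) = e.symm y :=
    LinearMap.congr_fun hp (e.symm y)
  simp [h1, h2]

lemma finrank_le_of_comp_surjective [FiniteDimensional k B] {n : ℕ} {T : A →ₗ[k] B}
    {P : B →ₗ[k] (Fin n → k)} {S : (Fin n → k) →ₗ[k] A}
    (h : Function.Surjective (P ∘ₗ T ∘ₗ S)) : n ≤ finrank k (LinearMap.range (P ∘ₗ T)) := by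
  have h1 : LinearMap.range (P ∘ₗ T) = ⊤ := by
    rw [LinearMap.range_eq_top]
    intro y
    obtain ⟨z, hz⟩ := h y
    exact ⟨S z, hz⟩
  rw [h1]
  simp

lemma toMatrix'_mem_polyFun [FiniteDimensional k A] [FiniteDimensional k B] {n : ℕ}
    {N : X → A →ₗ[k] B} (hN : IsPolyMap k N)
    (P : B →ₗ[k] (Fin n → k)) (S : (Fin n → k) →ₗ[k] A) (i j : Fin n) :
    (fun x => LinearMap.toMatrix' (P ∘ₗ N x ∘ₗ S) i j) ∈ polyFun k X := by
  have := (hN.apply (.const (S (Pi.single j 1)))) (LinearMap.proj i ∘ₗ P)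
  convert this using 2
  simp [LinearMap.toMatrix'_apply]

/-- The rank of a polynomial family of linear maps is lower semicontinuous. -/
lemma exists_polyFun_finrank_range_le [FiniteDimensional k A] [FiniteDimensional k B]
    {N : X → A →ₗ[k] B} (hN : IsPolyMap k N) (x₀ : X) :
    ∃ g ∈ polyFun k X, g x₀ ≠ 0 ∧ ∀ x, g x ≠ 0 →
      finrank k (LinearMap.range (N x₀)) ≤ finrank k (LinearMap.range (N x)) := by
  obtain ⟨P, S, hPS⟩ := (N x₀).exists_frame
  refine ⟨fun x => (LinearMap.toMatrix' (P ∘ₗ N x ∘ₗ S)).det,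
    det_mem_polyFun (toMatrix'_mem_polyFun hN P S), by simp [hPS], fun x hx => ?_⟩
  have hs : Function.Surjective (P ∘ₗ N x ∘ₗ S) := by
    have hu : IsUnit (P ∘ₗ N x ∘ₗ S) := by
      rw [LinearMap.isUnit_iff_isUnit_det, ← LinearMap.det_toMatrix']
      exact isUnit_iff_ne_zero.2 hx
    exact ((Module.End.isUnit_iff _).1 hu).2
  refine (finrank_le_of_comp_surjective hs).trans ?_
  rw [LinearMap.range_comp]
  exact finrank_map_le P _

/-- A vector in the kernel of a member of maximal rank of a polynomial family of linear maps
extends to a polynomial family of vectors in the kernels. -/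
lemma exists_polyMap_mem_ker [Infinite k] [FiniteDimensional k A] [FiniteDimensional k B]
    {M : X → A →ₗ[k] B} (hM : IsPolyMap k M) {x₀ : X} {g : X → k} (hg : g ∈ polyFun k X)
    (hg₀ : ∃ y, g y ≠ 0)
    (hr : ∀ x, g x ≠ 0 → finrank k (LinearMap.range (M x)) ≤ finrank k (LinearMap.range (M x₀)))
    {v : A} (hv : M x₀ v = 0) :
    ∃ w : X → A, IsPolyMap k w ∧ w x₀ = v ∧ ∀ x, M x (w x) = 0 := by
  obtain ⟨P, S, hPS⟩ := (M x₀).exists_frame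
  set D := fun x => LinearMap.toMatrix' (P ∘ₗ M x ∘ₗ S) with hD
  have hDp : ∀ i j, (fun x => D x i j) ∈ polyFun k X := toMatrix'_mem_polyFun hM P S
  have hdet : (fun x => (D x).det) ∈ polyFun k X := det_mem_polyFun hDp
  have hPMv : IsPolyMap k (fun x => P (M x v)) := (hM.apply (.const v)).comp_linear P
  have hD₀ : D x₀ = 1 := by simp [hD, hPS]
  have hadj : IsPolyMap k (fun x => (D x).adjugate.mulVec (P (M x v))) := by
    refine IsPolyMap.pi fun i => IsPolyMap.of_mem ?_
    simp only [Matrix.mulVec, dotProduct]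
    exact sum_mem_polyFun _ fun j _ => mul_mem_polyFun (adjugate_mem_polyFun hDp i j)
      (hPMv (LinearMap.proj j))
  set w : X → A := fun x => (D x).det • v + (-S) ((D x).adjugate.mulVec (P (M x v))) with hw
  have hwp : IsPolyMap k w := (IsPolyMap.smul hdet (.const v)).add (hadj.comp_linear (-S))
  refine ⟨w, hwp, by simp [hw, hD₀, hv], fun x => ?_⟩
  have hPw : ∀ x, P (M x (w x)) = 0 := by
    intro x
    have e : ∀ y, P (M x (S y)) = (D x).mulVec y := by
      intro y
      simp only [hD]
      rw [LinearMap.toMatrix'_mulVec]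
      rfl
    simp only [hw, map_add, map_smul, LinearMap.neg_apply, map_neg, e, Matrix.mulVec_mulVec,
      Matrix.mul_adjugate, Matrix.smul_mulVec, Matrix.one_mulVec, add_neg_cancel]
  rw [← Module.forall_dual_apply_eq_zero_iff k]
  intro l
  have hlp : (fun x => l (M x (w x))) ∈ polyFun k X := (hM.apply hwp) l
  obtain ⟨y, hy⟩ := hg₀
  obtain ⟨z, hz, hz'⟩ := exists_ne_zero_of_mem_polyFun hg hdet hy (y := x₀) (by simp [hD₀])
  refine polyFun_eq_zero hlp (mul_mem_polyFun hg hdet) (mul_ne_zero hz hz') (fun x hx => ?_) x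
  have hs : Function.Surjective (P ∘ₗ M x ∘ₗ S) := by
    have hu : IsUnit (P ∘ₗ M x ∘ₗ S) := by
      rw [LinearMap.isUnit_iff_isUnit_det, ← LinearMap.det_toMatrix']
      exact isUnit_iff_ne_zero.2 (right_ne_zero_of_mul hx)
    exact ((Module.End.isUnit_iff _).1 hu).2
  have h1 := (hr x (left_ne_zero_of_mul hx)).trans (finrank_le_of_comp_surjective hs)
  have h2 : LinearMap.ker (M x) = LinearMap.ker (P ∘ₗ M x) := by
    refine eq_of_le_of_finrank_le (LinearMap.ker_le_ker_comp _ _) ?_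
    have r1 := LinearMap.finrank_range_add_finrank_ker (M x)
    have r2 := LinearMap.finrank_range_add_finrank_ker (P ∘ₗ M x)
    omega
  have h3 : w x ∈ LinearMap.ker (M x) := by
    rw [h2]
    exact hPw x
  rw [LinearMap.mem_ker.1 h3, map_zero]

end Families

section Generic

variable {k X A Y B C ι : Type*} [Field k] [Infinite k]
  [AddCommGroup X] [Module k X] [FiniteDimensional k X]
  [AddCommGroup A] [Module k A] [FiniteDimensional k A]
  [AddCommGroup Y] [Module k Y] [FiniteDimensional k Y]
  [AddCommGroup B] [Module k B] [FiniteDimensional k B]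
  [AddCommGroup C] [Module k C] [FiniteDimensional k C] [Fintype ι]

lemma exists_maximal_nat {α : Type*} (p : α → Prop) (f : α → ℕ) (N : ℕ) (hN : ∀ a, f a ≤ N)
    (hp : ∃ a, p a) : ∃ a, p a ∧ ∀ b, p b → f b ≤ f a := by
  obtain ⟨a, ha, hmin⟩ := WellFounded.has_min (measure fun a => N - f a).wf {a | p a} hp
  refine ⟨a, ha, fun b hb => ?_⟩
  have h1 : ¬ (N - f b < N - f a) := hmin b hb
  have h2 := hN a
  have h3 := hN b
  omega

/-- Deformation theory of a generic member of the kernels of a linear family `M` of linear maps: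
first-order deformations of the base point lift to the kernel, and they preserve, to first order,
the kernels of all members of a finite collection of linear maps depending linearly on the
kernel vector. -/
theorem exists_generic_kernel (M : X →ₗ[k] A →ₗ[k] Y) (N : ι → A →ₗ[k] B →ₗ[k] C)
    {g : X → k} (hg : g ∈ polyFun k X) (hg₀ : ∃ x, g x ≠ 0) :
    ∃ g' ∈ polyFun k X, (∃ x, g' x ≠ 0) ∧ ∀ x, g' x ≠ 0 → g x ≠ 0 ∧
      ∃ α₀, M x α₀ = 0 ∧ ∀ α, M x α = 0 →
        (∀ i, finrank k (LinearMap.range (N i α₀)) ≤ finrank k (LinearMap.range (N i α))) →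
        (∀ x', ∃ α', M x' α + M x α' = 0) ∧
        ∀ x' α', M x' α + M x α' = 0 →
          ∀ i y, N i α y = 0 → N i α' y ∈ LinearMap.range (N i α) := by
  classical
  have hid : (fun t : k => t) ∈ polyFun k k := dual_mem_polyFun (LinearMap.id : k →ₗ[k] k)
  obtain ⟨x₁, hx₁, hmax₁⟩ := exists_maximal_nat (fun x => g x ≠ 0)
    (fun x => finrank k (LinearMap.range (M x))) _ (fun x => finrank_le _) hg₀
  set ρ := finrank k (LinearMap.range (M x₁)) with hρ
  obtain ⟨⟨x₀, α₀⟩, ⟨hx₀, hρ₀, hker₀⟩, hmax⟩ := exists_maximal_nat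
    (fun p : X × A => g p.1 ≠ 0 ∧ finrank k (LinearMap.range (M p.1)) = ρ ∧ M p.1 p.2 = 0)
    (fun p => ∑ i, finrank k (LinearMap.range (N i p.2))) (∑ _i : ι, finrank k C)
    (fun p => Finset.sum_le_sum fun i _ => finrank_le _) ⟨(x₁, 0), hx₁, rfl, map_zero _⟩
  simp only at hx₀ hρ₀ hker₀ hmax
  obtain ⟨w, hwp, hw₀, hw⟩ := exists_polyMap_mem_ker (IsPolyMap.linear M) hg hg₀
    (fun x hx => (hmax₁ x hx).trans hρ₀.ge) hker₀
  obtain ⟨gM, hgM, hgM₀, hgMr⟩ := exists_polyFun_finrank_range_le (IsPolyMap.linear M) x₀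
  choose gN hgN hgN₀ hgNr using fun i =>
    exists_polyFun_finrank_range_le (hwp.comp_linear (N i)) x₀
  refine ⟨fun x => g x * gM x * ∏ i, gN i x,
    mul_mem_polyFun (mul_mem_polyFun hg hgM) (prod_mem_polyFun _ fun i _ => hgN i),
    ⟨x₀, mul_ne_zero (mul_ne_zero hx₀ hgM₀) (Finset.prod_ne_zero_iff.2 fun i _ => hgN₀ i)⟩,
    fun x hx => ?_⟩
  have hgx : g x ≠ 0 := left_ne_zero_of_mul (left_ne_zero_of_mul hx)
  have hρx : finrank k (LinearMap.range (M x)) = ρ :=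
    le_antisymm (hmax₁ x hgx)
      (hρ₀.symm.le.trans (hgMr x (right_ne_zero_of_mul (left_ne_zero_of_mul hx))))
  refine ⟨hgx, w x, hw x, fun α hα hNα => ?_⟩
  have hαmax : ∀ z β, g z ≠ 0 → finrank k (LinearMap.range (M z)) = ρ → M z β = 0 →
      ∑ i, finrank k (LinearMap.range (N i β)) ≤ ∑ i, finrank k (LinearMap.range (N i α)) := by
    intro z β h1 h2 h3
    refine (hmax (z, β) ⟨h1, h2, h3⟩).trans (Finset.sum_le_sum fun i _ => ?_)
    refine le_trans ?_ (hNα i)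
    have := hgNr i x (Finset.prod_ne_zero_iff.1 (right_ne_zero_of_mul hx) i (Finset.mem_univ _))
    rwa [hw₀] at this
  have lift : ∀ (x' : X) (β : A), M x β = 0 → ∃ v : k → A, IsPolyMap k v ∧ v 0 = β ∧
      ∀ t, M (x + t • x') (v t) = 0 := by
    intro x' β hβ
    have hMl : IsPolyMap k (fun t : k => M (x + t • x')) :=
      (IsPolyMap.linear M).comp_line x x'
    obtain ⟨v, hvp, hv₀, hv⟩ := exists_polyMap_mem_ker (x₀ := 0) hMl (polyFun_comp_line hg x x')
      ⟨0, by simpa using hgx⟩ (fun t ht => by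
        rw [zero_smul, add_zero, hρx]
        exact hmax₁ _ ht) (v := β) (by simpa using hβ)
    exact ⟨v, hvp, hv₀, hv⟩
  have deriv : ∀ (x' : X) (v : k → A) (a : A) (h : k → A), IsPolyMap k h →
      (∀ t, v t = v 0 + t • a + t ^ 2 • h t) → (∀ t, M (x + t • x') (v t) = 0) →
      M x' (v 0) + M x a = 0 := by
    intro x' v a h hh hv h0
    have := bilin_deriv_eq_zero M (v := fun t : k => x + t • x') (g := fun _ => 0)
      (v1 := x') (IsPolyMap.const _) hh (by simp) hv h0
    simpa using this
  refine ⟨fun x' => ?_, fun x' α' h' i y hy => ?_⟩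
  · obtain ⟨v, hvp, hv₀, hv⟩ := lift x' α hα
    obtain ⟨a, h, hh, hta⟩ := hvp.exists_taylor
    exact ⟨a, by simpa [hv₀] using deriv x' v a h hh hta hv⟩
  · obtain ⟨v, hvp, hv₀, hv⟩ := lift x' α hα
    obtain ⟨a, h, hh, hta⟩ := hvp.exists_taylor
    have hd := deriv x' v a h hh hta hv
    rw [hv₀] at hd
    have hβ : M x (α' - a) = 0 := by
      rw [map_sub, sub_eq_zero]
      exact add_left_cancel (h'.trans hd.symm)
    obtain ⟨u, hup, hu₀, hu⟩ := lift x' (α' - a) hβ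
    obtain ⟨b, f, hf, htb⟩ := hup.exists_taylor
    set c : k → A := fun t => v t + t • u t with hc
    have hcp : IsPolyMap k c := hvp.add (.smul hid hup)
    have hc₀ : c 0 = α := by simp [hc, hv₀]
    have hcker : ∀ t, M (x + t • x') (c t) = 0 := by
      intro t
      rw [hc]
      simp only [map_add (M (x + t • x')), map_smul (M (x + t • x')), hv t, hu t, smul_zero,
        add_zero]
    have hct : ∀ t, c t = c 0 + t • α' + t ^ 2 • (h t + (b + t • f t)) := by
      intro t
      rw [hc₀, ← hv₀, hc]
      simp only
      conv_lhs => rw [hta t, htb t, hu₀]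
      module
    obtain ⟨g₁, hg₁, hg₁0, hg₁r⟩ := exists_polyFun_finrank_range_le
      ((IsPolyMap.linear M).comp_line x x') 0
    choose g₂ hg₂ hg₂0 hg₂r using fun i =>
      exists_polyFun_finrank_range_le (hcp.comp_linear (N i)) 0
    obtain ⟨z, hzp, hz₀, hz⟩ := exists_polyMap_mem_ker (x₀ := 0) (hcp.comp_linear (N i))
      (g := fun t => g (x + t • x') * g₁ t * ∏ i, g₂ i t)
      (mul_mem_polyFun (mul_mem_polyFun (polyFun_comp_line hg x x') hg₁)
        (prod_mem_polyFun _ fun i _ => hg₂ i))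
      ⟨0, mul_ne_zero (mul_ne_zero (by simpa using hgx) hg₁0)
        (Finset.prod_ne_zero_iff.2 fun i _ => hg₂0 i)⟩
      (fun t ht => by
        have h1 : g (x + t • x') ≠ 0 := left_ne_zero_of_mul (left_ne_zero_of_mul ht)
        have h2 : finrank k (LinearMap.range (M (x + t • x'))) = ρ := by
          refine le_antisymm (hmax₁ _ h1) ?_
          have := hg₁r t (right_ne_zero_of_mul (left_ne_zero_of_mul ht))
          rwa [zero_smul, add_zero, hρx] at this
        have h3 := hαmax _ _ h1 h2 (hcker t)
        have h4 : ∀ i ∈ Finset.univ, finrank k (LinearMap.range (N i α))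
            ≤ finrank k (LinearMap.range (N i (c t))) := by
          intro i _
          have := hg₂r i t
            (Finset.prod_ne_zero_iff.1 (right_ne_zero_of_mul ht) i (Finset.mem_univ _))
          rwa [hc₀] at this
        have h5 := (Finset.sum_eq_sum_iff_of_le h4).1 (le_antisymm (Finset.sum_le_sum h4) h3)
        rw [hc₀]
        exact (h5 i (Finset.mem_univ _)).ge)
      (v := y) (by rw [hc₀]; exact hy)
    obtain ⟨y', f', hf', hty⟩ := hzp.exists_taylor
    have := bilin_deriv_eq_zero (N i) (hh.add ((IsPolyMap.const b).add (.smul hid hf))) hf'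
      hct hty hz
    rw [hc₀, hz₀] at this
    refine ⟨-y', ?_⟩
    rw [map_neg, eq_comm, ← sub_eq_zero, sub_neg_eq_add]
    exact this

end Generic

/-! ### Coordinate subspaces and first-order deformations inside a Schubert position -/

section Coordinates

variable {k : Type*} [Field k]

lemma Submodule.finrank_map_add_finrank_inf_ker {A B : Type*} [AddCommGroup A] [Module k A]
    [AddCommGroup B] [Module k B] [FiniteDimensional k A] (f : A →ₗ[k] B) (S : Submodule k A) :
    finrank k (S.map f) + finrank k (S ⊓ LinearMap.ker f : Submodule k A) = finrank k S := by
  rw [← LinearMap.finrank_range_add_finrank_ker (f.domRestrict S), LinearMap.range_domRestrict,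
    LinearMap.ker_domRestrict, ← Submodule.map_comap_subtype]
  congr 1
  exact (Submodule.equivMapOfInjective S.subtype S.injective_subtype _).finrank_eq.symm

/-- The span of the first `u` vectors of the standard basis. -/
def coordSubspace (k : Type*) [Field k] (m u : ℕ) : Submodule k (Fin m → k) where
  carrier := {v | ∀ l : Fin m, u ≤ l → v l = 0}
  add_mem' ha hb l hl := by simp [ha l hl, hb l hl]
  zero_mem' _ _ := rfl
  smul_mem' c v hv l hl := by simp [hv l hl]

lemma mem_coordSubspace {m u : ℕ} {v : Fin m → k} :
    v ∈ coordSubspace k m u ↔ ∀ l : Fin m, u ≤ l → v l = 0 := Iff.rfl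

lemma coordSubspace_mono {m u u' : ℕ} (h : u ≤ u') :
    coordSubspace k m u ≤ coordSubspace k m u' := fun _ hv l hl => hv l (h.trans hl)

lemma finrank_coordSubspace {m u : ℕ} (h : u ≤ m) : finrank k (coordSubspace k m u) = u := by
  let e : coordSubspace k m u ≃ₗ[k] (Fin u → k) :=
    { toFun := fun v l => v.1 (Fin.castLE h l)
      map_add' := fun _ _ => rfl
      map_smul' := fun _ _ => rfl
      invFun := fun y => ⟨fun l => if hl : (l : ℕ) < u then y ⟨l, hl⟩ else 0,
        fun l hl => by simp [hl]⟩
      left_inv := fun v => by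
        ext l
        by_cases hl : (l : ℕ) < u
        · simp [hl]
        · simp [hl, v.2 l (not_lt.1 hl)]
      right_inv := fun y => by
        ext l
        simp }
  rw [e.finrank_eq]
  simp

lemma linearCombination_mem {C : Type*} [AddCommGroup C] [Module k C] {r u : ℕ}
    {χ : Fin r → C} {P : Submodule k C} (hχ : ∀ c : Fin r, (c : ℕ) < u → χ c ∈ P)
    {y : Fin r → k} (hy : y ∈ coordSubspace k r u) : Fintype.linearCombination k χ y ∈ P := by
  rw [Fintype.linearCombination_apply]
  refine P.sum_mem fun c _ => ?_
  by_cases hc : (c : ℕ) < u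
  · exact P.smul_mem _ (hχ c hc)
  · rw [hy c (not_lt.1 hc), zero_smul]
    exact P.zero_mem

lemma apply_mem_of_linearCombination_mem {C : Type*} [AddCommGroup C] [Module k C] {r : ℕ}
    {χ : Fin r → C} {P : Submodule k C} {a : Fin r} (hχ : ∀ c < a, χ c ∈ P)
    {y : Fin r → k} (hy : y ∈ coordSubspace k r (a + 1)) (hya : y a = 1)
    (h : Fintype.linearCombination k χ y ∈ P) : χ a ∈ P := by
  have h1 : y - Pi.single a 1 ∈ coordSubspace k r a := by
    intro l hl
    rcases eq_or_ne l a with rfl | hne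
    · simp [hya]
    · have : (l : ℕ) ≠ a := fun h => hne (Fin.ext h)
      simp [hne, hy l (by omega)]
  have h2 := linearCombination_mem (χ := χ) (P := P) (fun c hc => hχ c hc) h1
  rw [map_sub, Fintype.linearCombination_apply_single, one_smul] at h2
  have := P.sub_mem h h2
  simpa using this

/-- Tuples of vectors subject to the flag conditions `χ' a ∈ k^{m a}` which preserve, to first
order, the position of the kernel of the linear map with columns `χ`. -/
def kernelPreserving {r q : ℕ} (m : Fin r → ℕ) (χ : Fin r → Fin q → k) :
    Submodule k (Fin r → Fin q → k) where
  carrier := {χ' | (∀ a, χ' a ∈ coordSubspace k q (m a)) ∧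
    ∀ u ≤ r, ∀ y ∈ coordSubspace k r u, Fintype.linearCombination k χ y = 0 →
      Fintype.linearCombination k χ' y
        ∈ (coordSubspace k r u).map (Fintype.linearCombination k χ)}
  add_mem' := fun {a b} ha hb => ⟨fun c => add_mem (ha.1 c) (hb.1 c), fun u hu y hy h0 => by
    have : Fintype.linearCombination k (a + b) y
        = Fintype.linearCombination k a y + Fintype.linearCombination k b y := by
      simp [Fintype.linearCombination_apply, Finset.sum_add_distrib]
    rw [this]
    exact add_mem (ha.2 u hu y hy h0) (hb.2 u hu y hy h0)⟩
  zero_mem' := ⟨fun c => zero_mem _, fun u hu y hy h0 => by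
    simp [Fintype.linearCombination_apply]⟩
  smul_mem' := fun t a ha => ⟨fun c => smul_mem _ t (ha.1 c), fun u hu y hy h0 => by
    have : Fintype.linearCombination k (t • a) y = t • Fintype.linearCombination k a y := by
      simp [Fintype.linearCombination_apply, Finset.smul_sum, smul_comm t]
    rw [this]
    exact smul_mem _ t (ha.2 u hu y hy h0)⟩

lemma card_filter_strictMono_le {r d : ℕ} {K : Fin d → Fin r} (hK : StrictMono K) (t : Fin d) :
    (Finset.univ.filter fun t' : Fin d => (K t' : ℕ) + 1 ≤ K t + 1).card = t + 1 := by
  have : (Finset.univ.filter fun t' : Fin d => (K t' : ℕ) + 1 ≤ K t + 1) = Finset.Iic t := by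
    ext t'
    simp [Fin.val_fin_le, hK.le_iff_le]
  rw [this, Fin.card_Iic]

/-- The vectors of a basis adapted to the kernel of the linear map with columns `χ` and to the
standard flag. -/
lemma exists_adapted_vectors {r q d : ℕ} (χ : Fin r → Fin q → k) {K : Fin d → Fin r}
    (hpos : ∀ u ≤ r, finrank k (coordSubspace k r u ⊓
        LinearMap.ker (Fintype.linearCombination k χ) : Submodule k (Fin r → k))
      = (Finset.univ.filter fun t : Fin d => (K t : ℕ) + 1 ≤ u).card) (a : Fin r) :
    ∃ y ∈ coordSubspace k r (a + 1), y a = 1 ∧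
      (a ∈ Set.range K → Fintype.linearCombination k χ y = 0) := by
  by_cases ha : a ∈ Set.range K
  · obtain ⟨t, rfl⟩ := ha
    have hlt : (Finset.univ.filter fun t' : Fin d => (K t' : ℕ) + 1 ≤ K t).card
        < (Finset.univ.filter fun t' : Fin d => (K t' : ℕ) + 1 ≤ K t + 1).card := by
      refine Finset.card_lt_card (Finset.ssubset_iff_of_subset ?_ |>.2 ⟨t, by simp, by simp⟩)
      intro t' ht'
      simp only [Finset.mem_filter, Finset.mem_univ, true_and] at ht' ⊢
      omega
    rw [← hpos _ (K t).isLt.le, ← hpos _ (K t).isLt] at hlt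
    obtain ⟨y, hy, hy'⟩ := SetLike.not_le_iff_exists.1
      (fun h => hlt.not_ge (Submodule.finrank_mono h))
    have hyt : y (K t) ≠ 0 := by
      intro h0
      refine hy' ⟨fun l hl => ?_, hy.2⟩
      rcases eq_or_lt_of_le hl with h | h
      · rwa [← Fin.ext h]
      · exact hy.1 l h
    refine ⟨(y (K t))⁻¹ • y, smul_mem _ _ hy.1, by simp [hyt], fun _ => ?_⟩
    rw [map_smul, LinearMap.mem_ker.1 hy.2, smul_zero]
  · refine ⟨Pi.single a 1, fun l hl => ?_, by simp, fun h => absurd h ha⟩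
    have : l ≠ a := by
      rintro rfl
      omega
    simp [this]

lemma linearCombination_mem_map_of_adapted {r q d : ℕ} {χ χ' : Fin r → Fin q → k}
    {K : Fin d → Fin r}
    (hpos : ∀ u ≤ r, finrank k (coordSubspace k r u ⊓
        LinearMap.ker (Fintype.linearCombination k χ) : Submodule k (Fin r → k))
      = (Finset.univ.filter fun t : Fin d => (K t : ℕ) + 1 ≤ u).card)
    {y : Fin r → Fin r → k} (hy : ∀ a : Fin r, y a ∈ coordSubspace k r (a + 1)) (hya : ∀ a, y a a = 1)
    (hyK : ∀ a ∈ Set.range K, Fintype.linearCombination k χ (y a) = 0)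
    (h : ∀ a ∈ Set.range K, Fintype.linearCombination k χ' (y a)
      ∈ (coordSubspace k r (a + 1)).map (Fintype.linearCombination k χ)) :
    ∀ u ≤ r, ∀ z ∈ coordSubspace k r u, Fintype.linearCombination k χ z = 0 →
      Fintype.linearCombination k χ' z
        ∈ (coordSubspace k r u).map (Fintype.linearCombination k χ) := by
  intro u
  induction u with
  | zero =>
    intro _ z hz _
    have : z = 0 := funext fun l => hz l (Nat.zero_le _)
    simp [this]
  | succ u ih =>
    intro hu z hz hz0
    have hmono : (coordSubspace k r u).map (Fintype.linearCombination k χ)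
        ≤ (coordSubspace k r (u + 1)).map (Fintype.linearCombination k χ) :=
      Submodule.map_mono (coordSubspace_mono u.le_succ)
    set a : Fin r := ⟨u, hu⟩ with ha
    by_cases haK : a ∈ Set.range K
    · have h1 : z - z a • y a ∈ coordSubspace k r u := by
        intro l hl
        rcases eq_or_lt_of_le hl with h | h
        · have : l = a := Fin.ext h.symm
          simp [this, hya]
        · simp [hz l h, hy a l h]
      have h2 := ih (Nat.le_of_succ_le hu) _ h1 (by simp [hz0, hyK a haK])
      have h3 := add_mem (hmono h2) (smul_mem _ (z a) (h a haK))
      simpa using h3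
    · have hle : coordSubspace k r u ⊓ LinearMap.ker (Fintype.linearCombination k χ)
          ≤ coordSubspace k r (u + 1) ⊓ LinearMap.ker (Fintype.linearCombination k χ) :=
        inf_le_inf_right _ (coordSubspace_mono u.le_succ)
      have heq := Submodule.eq_of_le_of_finrank_eq hle (by
        rw [hpos u (Nat.le_of_succ_le hu), hpos (u + 1) hu]
        congr 1
        refine Finset.filter_congr fun t _ => ?_
        have : (K t : ℕ) ≠ u := fun h => haK ⟨t, Fin.ext h⟩
        omega)
      have hz' : z ∈ coordSubspace k r u ⊓ LinearMap.ker (Fintype.linearCombination k χ) := by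
        rw [heq]
        exact ⟨hz, hz0⟩
      exact hmono (ih (Nat.le_of_succ_le hu) z hz'.1 hz0)

lemma finrank_kernelPreserving {r q d : ℕ} {m : Fin r → ℕ} (hm : Monotone m)
    (hmq : ∀ a, m a ≤ q) {χ : Fin r → Fin q → k} (hχ : ∀ a, χ a ∈ coordSubspace k q (m a))
    {K : Fin d → Fin r} (hK : StrictMono K)
    (hpos : ∀ u ≤ r, finrank k (coordSubspace k r u ⊓
        LinearMap.ker (Fintype.linearCombination k χ) : Submodule k (Fin r → k))
      = (Finset.univ.filter fun t : Fin d => (K t : ℕ) + 1 ≤ u).card) :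
    (finrank k (kernelPreserving m χ) : ℤ)
      = ∑ a, (m a : ℤ) + ∑ t, (((K t : ℕ) : ℤ) - ((t : ℕ) : ℤ) - (m (K t) : ℤ)) := by
  classical
  choose y hy hya hyK using exists_adapted_vectors χ hpos
  set W : Fin r → Submodule k (Fin q → k) := fun a =>
    if a ∈ Set.range K then (coordSubspace k r (a + 1)).map (Fintype.linearCombination k χ)
    else coordSubspace k q (m a) with hW
  have hWle : ∀ a, W a ≤ coordSubspace k q (m a) := by
    intro a
    by_cases ha : a ∈ Set.range K
    · simp only [hW, ha, if_true]
      rintro _ ⟨z, hz, rfl⟩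
      exact linearCombination_mem (fun c hc =>
        coordSubspace_mono (hm (Fin.le_def.2 (Nat.lt_succ_iff.1 hc))) (hχ c)) hz
    · simp only [hW, ha, if_false, le_refl]
  set ev : (Fin r → Fin q → k) →ₗ[k] (Fin r → Fin q → k) :=
    LinearMap.pi fun a => (Fintype.bilinearCombination k k).flip (y a) with hev
  have hev_apply : ∀ χ' a, ev χ' a = Fintype.linearCombination k χ' (y a) := fun _ _ => rfl
  have hinj : Function.Injective ev := by
    rw [← LinearMap.ker_eq_bot, LinearMap.ker_eq_bot']
    intro χ' h0
    funext a
    rw [Pi.zero_apply, ← Submodule.mem_bot k]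
    induction a using WellFoundedLT.induction with
    | _ a ih =>
      refine apply_mem_of_linearCombination_mem ih (hy a) (hya a) ?_
      rw [← hev_apply, h0]
      simp
  have hsurj : Function.Surjective ev := LinearMap.injective_iff_surjective.1 hinj
  have hmem : ∀ χ', χ' ∈ kernelPreserving m χ ↔ ∀ a, ev χ' a ∈ W a := by
    intro χ'
    constructor
    · rintro ⟨h1, h2⟩ a
      rw [hev_apply]
      by_cases ha : a ∈ Set.range K
      · simp only [hW, ha, if_true]
        exact h2 _ a.isLt _ (hy a) (hyK a ha)
      · simp only [hW, ha, if_false]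
        exact linearCombination_mem (fun c hc =>
          coordSubspace_mono (hm (Fin.le_def.2 (Nat.lt_succ_iff.1 hc))) (h1 c)) (hy a)
    · intro h
      refine ⟨fun a => ?_, linearCombination_mem_map_of_adapted hpos hy hya hyK fun a ha => ?_⟩
      · induction a using WellFoundedLT.induction with
        | _ a ih =>
          exact apply_mem_of_linearCombination_mem
            (fun c hc => coordSubspace_mono (hm hc.le) (ih c hc)) (hy a) (hya a) (hWle a (h a))
      · have := h a
        simpa only [hW, ha, if_true, hev_apply] using this
  have hfin : finrank k (kernelPreserving m χ) = ∑ a, finrank k (W a) := by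
    have e : kernelPreserving m χ ≃ₗ[k] (∀ a, W a) := by
      refine LinearEquiv.ofBijective (LinearMap.pi fun a =>
        ((LinearMap.proj a ∘ₗ ev) ∘ₗ (kernelPreserving m χ).subtype).codRestrict (W a)
          (fun x => (hmem x.1).1 x.2 a)) ⟨?_, ?_⟩
      · intro x x' h
        refine Subtype.ext (hinj (funext fun a => ?_))
        exact congrArg Subtype.val (congrFun h a)
      · intro w
        obtain ⟨x, hx⟩ := hsurj (fun a => (w a : Fin q → k))
        refine ⟨⟨x, (hmem x).2 fun a => ?_⟩, ?_⟩
        · rw [hx]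
          exact (w a).2
        · funext a
          exact Subtype.ext (congrFun hx a)
    rw [e.finrank_eq, Module.finrank_pi_fintype]
  have hWK : ∀ t, (finrank k (W (K t)) : ℤ) = ((K t : ℕ) : ℤ) - ((t : ℕ) : ℤ) := by
    intro t
    have h1 := Submodule.finrank_map_add_finrank_inf_ker (Fintype.linearCombination k χ)
      (coordSubspace k r (K t + 1))
    rw [hpos _ (K t).isLt, card_filter_strictMono_le hK, finrank_coordSubspace (K t).isLt] at h1
    have e : W (K t) = (coordSubspace k r (K t + 1)).map (Fintype.linearCombination k χ) :=
      if_pos ⟨t, rfl⟩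
    rw [e]
    omega
  rw [hfin, Nat.cast_sum, ← sub_eq_iff_eq_add', ← Finset.sum_sub_distrib]
  refine (Fintype.sum_of_injective K hK.injective _ _ (fun a ha => ?_) (fun t => ?_)).symm
  · have e : W a = coordSubspace k q (m a) := if_neg ha
    rw [e, finrank_coordSubspace (hmq a), sub_self]
  · rw [hWK]

end Coordinates

/-! ### Counting dimensions around a linear map -/

section Counting

variable {k V Q : Type*} [Field k] [AddCommGroup V] [Module k V] [AddCommGroup Q] [Module k Q]

lemma LinearMap.exists_comp_eq_of_ker_le {C : Type*} [AddCommGroup C] [Module k C]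
    (φ : V →ₗ[k] Q) (f : V →ₗ[k] C) (h : LinearMap.ker φ ≤ LinearMap.ker f) :
    ∃ g : Q →ₗ[k] C, g ∘ₗ φ = f := by
  obtain ⟨g, hg⟩ := LinearMap.exists_extend
    ((LinearMap.ker φ).liftQ f h ∘ₗ φ.quotKerEquivRange.symm.toLinearMap)
  refine ⟨g, LinearMap.ext fun v => ?_⟩
  have h1 := LinearMap.congr_fun hg ⟨φ v, LinearMap.mem_range_self φ v⟩
  have h2 : φ.quotKerEquivRange.symm ⟨φ v, LinearMap.mem_range_self φ v⟩
      = (LinearMap.ker φ).mkQ v := by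
    rw [LinearEquiv.symm_apply_eq]
    exact Subtype.ext rfl
  simpa [h2] using h1

lemma LinearMap.exists_comp_eq_of_range_le {C : Type*} [AddCommGroup C] [Module k C]
    (φ : V →ₗ[k] Q) (f : C →ₗ[k] Q) (h : LinearMap.range f ≤ LinearMap.range φ) :
    ∃ g : C →ₗ[k] V, φ ∘ₗ g = f := by
  obtain ⟨g, hg⟩ := φ.rangeRestrict.exists_rightInverse_of_surjective φ.range_rangeRestrict
  refine ⟨g ∘ₗ f.codRestrict _ fun c => h (LinearMap.mem_range_self f c), LinearMap.ext fun c => ?_⟩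
  exact congrArg Subtype.val (LinearMap.congr_fun hg ⟨f c, h (LinearMap.mem_range_self f c)⟩)

/-- The tangent space at `φ` to the orbit of `φ` under base change on both sides. -/
lemma LinearMap.exists_comp_sub_comp (φ ψ : V →ₗ[k] Q)
    (h : ∀ v, φ v = 0 → ψ v ∈ LinearMap.range φ) :
    ∃ (β : V →ₗ[k] V) (γ : Q →ₗ[k] Q), ψ = φ ∘ₗ β - γ ∘ₗ φ := by
  obtain ⟨β₀, hβ₀⟩ := φ.exists_comp_eq_of_range_le (ψ ∘ₗ (LinearMap.ker φ).subtype) (by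
    rintro _ ⟨v, rfl⟩
    exact h v v.2)
  obtain ⟨β, hβ⟩ := LinearMap.exists_extend β₀
  obtain ⟨γ, hγ⟩ := φ.exists_comp_eq_of_ker_le (φ ∘ₗ β - ψ) (by
    intro v hv
    have h1 := LinearMap.congr_fun hβ₀ ⟨v, hv⟩
    have h2 := LinearMap.congr_fun hβ ⟨v, hv⟩
    simp only [LinearMap.comp_apply, Submodule.subtype_apply] at h1 h2
    simp [h2, h1])
  exact ⟨β, γ, by rw [hγ, sub_sub_cancel]⟩

/-- The normal map `Hom(V, Q) → Hom(ker φ, coker φ)`. -/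
def normalMap (φ : V →ₗ[k] Q) : (V →ₗ[k] Q) →ₗ[k] (LinearMap.ker φ →ₗ[k] Q ⧸ LinearMap.range φ) :=
  LinearMap.llcomp k _ _ _ (LinearMap.range φ).mkQ ∘ₗ
    LinearMap.lcomp k Q (LinearMap.ker φ).subtype

lemma normalMap_apply (φ ψ : V →ₗ[k] Q) (v : LinearMap.ker φ) :
    normalMap φ ψ v = (LinearMap.range φ).mkQ (ψ v) := rfl

lemma normalMap_surjective (φ : V →ₗ[k] Q) : Function.Surjective (normalMap φ) := by
  intro θ
  obtain ⟨g, hg⟩ := LinearMap.exists_comp_eq_of_range_le (LinearMap.range φ).mkQ θ (by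
    rw [Submodule.range_mkQ]
    exact le_top)
  obtain ⟨ψ, hψ⟩ := LinearMap.exists_extend g
  refine ⟨ψ, LinearMap.ext fun v => ?_⟩
  rw [normalMap_apply, ← hg, ← hψ]
  rfl

lemma mem_ker_normalMap {φ ψ : V →ₗ[k] Q} :
    ψ ∈ LinearMap.ker (normalMap φ) ↔ ∀ v, φ v = 0 → ψ v ∈ LinearMap.range φ := by
  rw [LinearMap.mem_ker, LinearMap.ext_iff]
  simp only [normalMap_apply, Submodule.mkQ_apply, LinearMap.zero_apply,
    Submodule.Quotient.mk_eq_zero]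
  exact ⟨fun h v hv => h ⟨v, hv⟩, fun h v => h v v.2⟩

/-- Dimension of an intersection of subspaces `E j` of `Hom(V, Q)` whose elements map `ker φ` to
`im φ`, when modulo the diagonal they contain all the tangent directions to the orbit of `φ`. -/
lemma finrank_iInf_of_tangent {ι : Type*} [Fintype ι] [Nonempty ι] [FiniteDimensional k V]
    [FiniteDimensional k Q] (φ : V →ₗ[k] Q) (E : ι → Submodule k (V →ₗ[k] Q))
    (hE : ∀ j, E j ≤ LinearMap.ker (normalMap φ))
    (htan : ∀ (β : ι → V →ₗ[k] V) (γ : ι → Q →ₗ[k] Q),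
      ∃ φ' : V →ₗ[k] Q, ∀ j, φ' - (φ ∘ₗ β j - γ j ∘ₗ φ) ∈ E j) :
    finrank k (⨅ j, E j : Submodule k (V →ₗ[k] Q))
        + Fintype.card ι * (finrank k V * finrank k Q)
        + finrank k (LinearMap.ker φ) * finrank k (Q ⧸ LinearMap.range φ)
      = finrank k V * finrank k Q + ∑ j, finrank k (E j)
        + Fintype.card ι * (finrank k (LinearMap.ker φ) * finrank k (Q ⧸ LinearMap.range φ)) := by
  classical
  set M : ((V →ₗ[k] Q) × (∀ j, E j)) →ₗ[k] (ι → V →ₗ[k] Q) :=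
    LinearMap.pi fun j => LinearMap.fst k _ _ -
      (E j).subtype ∘ₗ LinearMap.proj j ∘ₗ LinearMap.snd k _ _ with hM
  have hM_apply : ∀ p j, M p j = p.1 - p.2 j := fun _ _ => rfl
  set T : (ι → V →ₗ[k] Q) →ₗ[k] (ι → LinearMap.ker φ →ₗ[k] Q ⧸ LinearMap.range φ) :=
    LinearMap.pi fun j => normalMap φ ∘ₗ LinearMap.proj j with hT
  have hT_apply : ∀ p j, T p j = normalMap φ (p j) := fun _ _ => rfl
  have hTsurj : Function.Surjective T := by
    intro θ
    choose ψ hψ using fun j => normalMap_surjective φ (θ j)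
    exact ⟨ψ, funext hψ⟩
  have hker : finrank k (LinearMap.ker M) = finrank k (⨅ j, E j : Submodule k (V →ₗ[k] Q)) := by
    refine LinearEquiv.finrank_eq (LinearEquiv.ofBijective
      ((LinearMap.fst k _ _ ∘ₗ (LinearMap.ker M).subtype).codRestrict _ fun p => ?_) ⟨?_, ?_⟩)
    · refine (Submodule.mem_iInf _).2 fun j => ?_
      have h := congrFun (LinearMap.mem_ker.1 p.2) j
      rw [hM_apply, Pi.zero_apply, sub_eq_zero] at h
      change p.1.1 ∈ E j
      rw [h]
      exact (p.1.2 j).2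
    · intro p p' h
      have h1 : p.1.1 = p'.1.1 := congrArg Subtype.val h
      refine Subtype.ext (Prod.ext h1 (funext fun j => Subtype.ext ?_))
      have h2 := congrFun (LinearMap.mem_ker.1 p.2) j
      have h3 := congrFun (LinearMap.mem_ker.1 p'.2) j
      rw [hM_apply, Pi.zero_apply, sub_eq_zero] at h2 h3
      rw [← h2, ← h3, h1]
    · intro x
      refine ⟨⟨(x.1, fun j => ⟨x.1, (Submodule.mem_iInf _).1 x.2 j⟩), ?_⟩, rfl⟩
      refine LinearMap.mem_ker.2 (funext fun j => ?_)
      rw [hM_apply]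
      exact sub_self _
  have hkerT : LinearMap.ker T ≤ LinearMap.range M := by
    intro ψ hψ
    have h1 : ∀ j, ψ j ∈ LinearMap.ker (normalMap φ) := fun j => congrFun hψ j
    choose β γ hβγ using fun j => φ.exists_comp_sub_comp (ψ j) (mem_ker_normalMap.1 (h1 j))
    obtain ⟨φ', hφ'⟩ := htan β γ
    refine ⟨(φ', fun j => ⟨_, hφ' j⟩), funext fun j => ?_⟩
    rw [hM_apply, hβγ j]
    exact sub_sub_cancel _ _
  have hmap : (LinearMap.range M).map T = LinearMap.range
      (LinearMap.pi fun _ : ι => (LinearMap.id : (LinearMap.ker φ →ₗ[k] Q ⧸ LinearMap.range φ)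
        →ₗ[k] _)) := by
    ext θ
    constructor
    · rintro ⟨_, ⟨p, rfl⟩, rfl⟩
      refine ⟨normalMap φ p.1, funext fun j => ?_⟩
      rw [hT_apply, hM_apply, map_sub, LinearMap.mem_ker.1 (hE j (p.2 j).2), sub_zero]
      rfl
    · rintro ⟨θ, rfl⟩
      obtain ⟨ψ, hψ⟩ := normalMap_surjective φ θ
      refine ⟨_, ⟨(ψ, 0), rfl⟩, funext fun j => ?_⟩
      rw [hT_apply, hM_apply, ← hψ]
      simp
  have h1 := Submodule.finrank_map_add_finrank_inf_ker T (LinearMap.range M)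
  rw [inf_eq_right.2 hkerT, hmap, LinearMap.finrank_range_of_inj (fun x y h =>
    congrFun h (Classical.arbitrary ι)), Module.finrank_linearMap] at h1
  have h2 := LinearMap.finrank_range_add_finrank_ker T
  rw [LinearMap.range_eq_top.2 hTsurj, finrank_top, Module.finrank_pi_fintype,
    Module.finrank_pi_fintype] at h2
  simp only [Module.finrank_linearMap, Finset.sum_const, Finset.card_univ, smul_eq_mul] at h2
  have h3 := LinearMap.finrank_range_add_finrank_ker M
  rw [hker, Module.finrank_prod, Module.finrank_pi_fintype, Module.finrank_linearMap] at h3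
  linarith

end Counting

/-! ### Linear maps in coordinates -/

section Columns

variable {k V Q : Type*} [Field k] [AddCommGroup V] [Module k V] [AddCommGroup Q] [Module k Q]
  {r q : ℕ}

/-- The columns of the matrix of a linear map. -/
def columns (b : Basis (Fin r) k V) (c : Basis (Fin q) k Q) :
    (V →ₗ[k] Q) ≃ₗ[k] (Fin r → Fin q → k) :=
  (b.constr k).symm ≪≫ₗ LinearEquiv.piCongrRight fun _ => c.equivFun

lemma columns_apply (b : Basis (Fin r) k V) (c : Basis (Fin q) k Q) (φ : V →ₗ[k] Q) (a : Fin r) :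
    columns b c φ a = c.equivFun (φ (b a)) := rfl

lemma linearCombination_columns (b : Basis (Fin r) k V) (c : Basis (Fin q) k Q) (φ : V →ₗ[k] Q)
    (v : V) :
    Fintype.linearCombination k (columns b c φ) (b.equivFun v) = c.equivFun (φ v) := by
  conv_rhs => rw [← b.sum_equivFun v]
  simp only [Fintype.linearCombination_apply, columns_apply, map_sum, map_smul]

lemma sum_columns_smul (b : Basis (Fin r) k V) (c : Basis (Fin q) k Q) (φ : V →ₗ[k] Q)
    (a : Fin r) : ∑ l, columns b c φ a l • c l = φ (b a) := by
  rw [columns_apply, c.sum_equivFun]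

lemma mem_spanFlag_iff (b : Basis (Fin r) k V) {u : ℕ} {v : V} :
    v ∈ spanFlag k b u ↔ b.equivFun v ∈ coordSubspace k r u := by
  rw [spanFlag, b.mem_span_image, mem_coordSubspace]
  simp only [Set.subset_def, Finset.mem_coe, Finsupp.mem_support_iff, Set.mem_ofPred_eq,
    Basis.equivFun_apply]
  exact forall_congr' fun l => by rw [← not_imp_not, not_not, not_lt]

lemma map_spanFlag_inf_ker (b : Basis (Fin r) k V) (c : Basis (Fin q) k Q) (φ : V →ₗ[k] Q)
    (u : ℕ) :
    (LinearMap.ker φ ⊓ spanFlag k b u).map b.equivFun.toLinearMap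
      = coordSubspace k r u ⊓ LinearMap.ker (Fintype.linearCombination k (columns b c φ)) := by
  ext y
  obtain ⟨v, rfl⟩ := b.equivFun.surjective y
  rw [Submodule.mem_inf, LinearMap.mem_ker, linearCombination_columns,
    LinearEquiv.map_eq_zero_iff, ← mem_spanFlag_iff]
  constructor
  · rintro ⟨w, hw, h⟩
    obtain rfl : w = v := b.equivFun.injective h
    exact ⟨hw.2, hw.1⟩
  · exact fun h => ⟨v, ⟨h.2, h.1⟩, rfl⟩

lemma mem_homConstraint {p : Submodule k V} {p' : Submodule k Q} {φ : V →ₗ[k] Q} :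
    φ ∈ homConstraint p p' ↔ ∀ v ∈ p, φ v ∈ p' := by
  rw [homConstraint, LinearMap.mem_ker, LinearMap.ext_iff]
  simp only [LinearMap.comp_apply, LinearMap.llcomp_apply, LinearMap.lcomp_apply,
    Submodule.mkQ_apply, LinearMap.zero_apply, Submodule.Quotient.mk_eq_zero]
  exact ⟨fun h v hv => h ⟨v, hv⟩, fun h v => h v v.2⟩

/-- Tuples of vectors of `k^q` subject to the flag conditions `χ a ∈ k^{m a}`. -/
def flagTuples (k : Type*) [Field k] (q : ℕ) {r : ℕ} (m : Fin r → ℕ) :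
    Submodule k (Fin r → Fin q → k) :=
  Submodule.pi Set.univ fun a => coordSubspace k q (m a)

lemma mem_flagTuples {m : Fin r → ℕ} {χ : Fin r → Fin q → k} :
    χ ∈ flagTuples k q m ↔ ∀ a, χ a ∈ coordSubspace k q (m a) := by
  simp [flagTuples, Submodule.mem_pi]

lemma mem_homSpace_iff {n s : ℕ} {I : Fin s → Fin r → Fin n}
    (hI : ∀ j, Monotone fun a : Fin r => (I j a : ℕ) - (a : ℕ))
    (b : Fin s → Basis (Fin r) k V) (c : Fin s → Basis (Fin q) k Q) {φ : V →ₗ[k] Q} :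
    φ ∈ homSpace I (fun j => spanFlag k (b j)) (fun j => spanFlag k (c j))
      ↔ ∀ j, columns (b j) (c j) φ ∈ flagTuples k q fun a => (I j a : ℕ) - (a : ℕ) := by
  simp only [homSpace, Submodule.mem_iInf, mem_homConstraint, mem_flagTuples]
  refine forall_congr' fun j => ⟨fun h a => ?_, fun h a v hv => ?_⟩
  · rw [columns_apply, ← mem_spanFlag_iff]
    exact h a _ (Submodule.subset_span ⟨a, Nat.lt_succ_self _, rfl⟩)
  · rw [mem_spanFlag_iff, ← linearCombination_columns (b j)]
    exact linearCombination_mem (fun l hl => coordSubspace_mono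
      (hI j (Fin.le_def.2 (Nat.lt_succ_iff.1 hl))) (h l)) ((mem_spanFlag_iff _).1 hv)

lemma exists_basis_of_linearIndependent [FiniteDimensional k V] (hV : finrank k V = r)
    {b : Fin r → V} (hb : LinearIndependent k b) : ∃ B : Basis (Fin r) k V, ⇑B = b :=
  ⟨Basis.mk hb (hb.span_eq_top_of_card_eq_finrank' (by simp [hV])).ge, Basis.coe_mk _ _⟩

end Columns

/-! ### The incidence family -/

section Incidence

variable {k V Q : Type*} [Field k] [AddCommGroup V] [Module k V] [AddCommGroup Q] [Module k Q]
  {r q s : ℕ}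

/-- The space of pairs consisting of a linear map and of candidate tuples of coordinates for it. -/
abbrev IncidenceSource (k V Q : Type*) [Field k] [AddCommGroup V] [Module k V] [AddCommGroup Q]
    [Module k Q] (q : ℕ) {r s : ℕ} (m : Fin s → Fin r → ℕ) : Type _ :=
  (V →ₗ[k] Q) × ∀ j, flagTuples k q (m j)

/-- The defect of `χ j` to be the tuple of columns of `φ` in the bases `x.1 j`, `x.2 j`. -/
def incidenceMap (m : Fin s → Fin r → ℕ) :
    ((Fin s → Fin r → V) × (Fin s → Fin q → Q)) →ₗ[k] IncidenceSource k V Q q m →ₗ[k]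
      (Fin s → Fin r → Q) :=
  LinearMap.mk₂ k
    (fun x α j a => α.1 (x.1 j a) - ∑ l, (α.2 j : Fin r → Fin q → k) a l • x.2 j l)
    (fun x x' α => by
      ext j a
      simp [Finset.sum_add_distrib]
      abel)
    (fun t x α => by
      ext j a
      simp [Finset.smul_sum, smul_sub, smul_comm t])
    (fun x α α' => by
      ext j a
      simp [Finset.sum_add_distrib, add_smul]
      abel)
    (fun t x α => by
      ext j a
      simp [Finset.smul_sum, smul_sub, mul_smul])

lemma incidenceMap_apply (m : Fin s → Fin r → ℕ)
    (x : (Fin s → Fin r → V) × (Fin s → Fin q → Q)) (α : IncidenceSource k V Q q m) (j : Fin s)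
    (a : Fin r) : incidenceMap m x α j a
      = α.1 (x.1 j a) - ∑ l, (α.2 j : Fin r → Fin q → k) a l • x.2 j l := rfl

lemma incidenceMap_eq_zero_iff (m : Fin s → Fin r → ℕ) (b : Fin s → Basis (Fin r) k V)
    (c : Fin s → Basis (Fin q) k Q) (α : IncidenceSource k V Q q m) :
    incidenceMap m (fun j => ⇑(b j), fun j => ⇑(c j)) α = 0
      ↔ ∀ j, (α.2 j : Fin r → Fin q → k) = columns (b j) (c j) α.1 := by
  rw [funext_iff]
  refine forall_congr' fun j => ?_
  rw [funext_iff, funext_iff]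
  refine forall_congr' fun a => ?_
  rw [incidenceMap_apply, Pi.zero_apply, Pi.zero_apply, sub_eq_zero, columns_apply,
    ← LinearEquiv.symm_apply_eq, Basis.equivFun_symm_apply, eq_comm]

/-- Truncation of a vector to its first `u` coordinates. -/
def truncate (k : Type*) [Field k] (r u : ℕ) : (Fin r → k) →ₗ[k] (Fin r → k) :=
  LinearMap.pi fun l => if (l : ℕ) < u then LinearMap.proj l else 0

lemma truncate_of_mem {u : ℕ} {y : Fin r → k} (hy : y ∈ coordSubspace k r u) :
    truncate k r u y = y := by
  ext l
  by_cases h : (l : ℕ) < u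
  · simp [truncate, h]
  · simp [truncate, h, hy l (not_lt.1 h)]

lemma truncate_mem (u : ℕ) (y : Fin r → k) : truncate k r u y ∈ coordSubspace k r u := by
  intro l hl
  simp [truncate, hl.not_gt]

/-- The restriction to the first `u` vectors of the standard basis of the linear map with given
columns. -/
def truncatedMap (k : Type*) [Field k] (r q u : ℕ) :
    (Fin r → Fin q → k) →ₗ[k] (Fin r → k) →ₗ[k] (Fin q → k) :=
  LinearMap.lcomp k _ (truncate k r u) ∘ₗ Fintype.bilinearCombination k k

lemma truncatedMap_apply (u : ℕ) (χ : Fin r → Fin q → k) (y : Fin r → k) :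
    truncatedMap k r q u χ y = Fintype.linearCombination k χ (truncate k r u y) := rfl

lemma range_truncatedMap (u : ℕ) (χ : Fin r → Fin q → k) :
    LinearMap.range (truncatedMap k r q u χ)
      = (coordSubspace k r u).map (Fintype.linearCombination k χ) := by
  ext z
  constructor
  · rintro ⟨y, rfl⟩
    exact ⟨_, truncate_mem u y, rfl⟩
  · rintro ⟨y, hy, rfl⟩
    exact ⟨y, by rw [truncatedMap_apply, truncate_of_mem hy]⟩

/-- The truncated maps attached to the columns of an incidence. -/
def positionMap (k V Q : Type*) [Field k] [AddCommGroup V] [Module k V] [AddCommGroup Q]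
    [Module k Q] (q : ℕ) (m : Fin s → Fin r → ℕ) (i : Fin s × Fin (r + 1)) :
    IncidenceSource k V Q q m →ₗ[k] (Fin r → k) →ₗ[k] (Fin q → k) :=
  truncatedMap k r q i.2 ∘ₗ (flagTuples k q (m i.1)).subtype ∘ₗ LinearMap.proj i.1 ∘ₗ
    LinearMap.snd k _ _

lemma positionMap_apply (m : Fin s → Fin r → ℕ) (i : Fin s × Fin (r + 1))
    (α : IncidenceSource k V Q q m) :
    positionMap k V Q q m i α = truncatedMap k r q i.2 (α.2 i.1) := rfl

lemma mem_kernelPreserving_of_positionMap {m : Fin s → Fin r → ℕ}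
    {α α' : IncidenceSource k V Q q m}
    (h : ∀ i y, positionMap k V Q q m i α y = 0 →
      positionMap k V Q q m i α' y ∈ LinearMap.range (positionMap k V Q q m i α)) (j : Fin s) :
    (α'.2 j : Fin r → Fin q → k) ∈ kernelPreserving (m j) (α.2 j) := by
  refine ⟨mem_flagTuples.1 (α'.2 j).2, fun u hu y hy h0 => ?_⟩
  have := h (j, ⟨u, Nat.lt_succ_of_le hu⟩) y
  rw [positionMap_apply, positionMap_apply, range_truncatedMap, truncatedMap_apply,
    truncatedMap_apply, truncate_of_mem hy] at this
  exact this h0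

end Incidence

section Conclusion

variable {k V Q : Type*} [Field k] [AddCommGroup V] [Module k V] [AddCommGroup Q] [Module k Q]
  {r q s : ℕ}

lemma finrank_comap_linearEquiv {A B : Type*} [AddCommGroup A] [Module k A] [AddCommGroup B]
    [Module k B] (e : A ≃ₗ[k] B) (S : Submodule k B) :
    finrank k (S.comap e.toLinearMap) = finrank k S := by
  have : S.comap e.toLinearMap = S.map e.symm.toLinearMap := S.comap_equiv_eq_map_symm e
  rw [this]
  exact e.symm.finrank_map_eq S

/-- Dimension count at an incidence where all first-order deformations of the bases lift and
preserve the position of the kernel. -/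
lemma finrank_iInf_flagTuples [NeZero s] [FiniteDimensional k V] [FiniteDimensional k Q]
    (m : Fin s → Fin r → ℕ) (b : Fin s → Basis (Fin r) k V) (c : Fin s → Basis (Fin q) k Q)
    (α : IncidenceSource k V Q q m)
    (hα : incidenceMap m (fun j => ⇑(b j), fun j => ⇑(c j)) α = 0)
    (hlift : ∀ x' : (Fin s → Fin r → V) × (Fin s → Fin q → Q),
      ∃ α' : IncidenceSource k V Q q m, incidenceMap m x' α
      + incidenceMap m (fun j => ⇑(b j), fun j => ⇑(c j)) α' = 0)
    (hpos : ∀ (x' : (Fin s → Fin r → V) × (Fin s → Fin q → Q))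
        (α' : IncidenceSource k V Q q m), incidenceMap m x' α
        + incidenceMap m (fun j => ⇑(b j), fun j => ⇑(c j)) α' = 0 →
      ∀ i y, positionMap k V Q q m i α y = 0 →
        positionMap k V Q q m i α' y ∈ LinearMap.range (positionMap k V Q q m i α)) :
    finrank k (⨅ j, (flagTuples k q (m j)).comap (columns (b j) (c j)).toLinearMap :
          Submodule k (V →ₗ[k] Q))
        + s * (finrank k V * finrank k Q)
        + finrank k (LinearMap.ker α.1) * finrank k (Q ⧸ LinearMap.range α.1)
      = finrank k V * finrank k Q
        + ∑ j, finrank k (kernelPreserving (m j) (columns (b j) (c j) α.1))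
        + s * (finrank k (LinearMap.ker α.1) * finrank k (Q ⧸ LinearMap.range α.1)) := by
  have hχ := (incidenceMap_eq_zero_iff m b c α).1 hα
  set E : Fin s → Submodule k (V →ₗ[k] Q) := fun j =>
    (kernelPreserving (m j) (columns (b j) (c j) α.1)).comap (columns (b j) (c j)).toLinearMap
    with hE
  have hmemE : ∀ j θ, θ ∈ E j ↔ columns (b j) (c j) θ
      ∈ kernelPreserving (m j) (columns (b j) (c j) α.1) := fun _ _ => Iff.rfl
  have hinf : (⨅ j, (flagTuples k q (m j)).comap (columns (b j) (c j)).toLinearMap :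
      Submodule k (V →ₗ[k] Q)) = ⨅ j, E j := by
    refine le_antisymm (le_iInf fun j θ hθ => ?_)
      (iInf_mono fun j θ hθ => mem_flagTuples.2 hθ.1)
    have hθ' := (Submodule.mem_iInf _).1 hθ
    have h0 : incidenceMap m (fun j => ⇑(b j), fun j => ⇑(c j))
        ((θ, fun j => ⟨_, hθ' j⟩) : IncidenceSource k V Q q m) = 0 :=
      (incidenceMap_eq_zero_iff m b c _).2 fun j => rfl
    have h1 := mem_kernelPreserving_of_positionMap (hpos 0 _ (by
      rw [h0, map_zero, LinearMap.zero_apply, add_zero])) j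
    rw [hχ j] at h1
    exact h1
  have hker : ∀ j, E j ≤ LinearMap.ker (normalMap α.1) := by
    intro j θ hθ
    rw [mem_ker_normalMap]
    intro v hv
    obtain ⟨y, -, hy⟩ := ((hmemE j θ).1 hθ).2 r le_rfl ((b j).equivFun v)
      (fun l hl => absurd l.isLt hl.not_gt)
      (by rw [linearCombination_columns, hv, map_zero])
    obtain ⟨w, rfl⟩ := (b j).equivFun.surjective y
    rw [linearCombination_columns, linearCombination_columns] at hy
    exact ⟨w, (c j).equivFun.injective hy⟩
  have htan : ∀ (β : Fin s → V →ₗ[k] V) (γ : Fin s → Q →ₗ[k] Q),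
      ∃ φ' : V →ₗ[k] Q, ∀ j, φ' - (α.1 ∘ₗ β j - γ j ∘ₗ α.1) ∈ E j := by
    intro β γ
    set x' : (Fin s → Fin r → V) × (Fin s → Fin q → Q) :=
      (fun j a => -β j (b j a), fun j l => -γ j (c j l)) with hx'
    obtain ⟨α', hα'⟩ := hlift x'
    refine ⟨α'.1, fun j => ?_⟩
    have h1 := mem_kernelPreserving_of_positionMap (hpos x' α' hα') j
    have h2 : (α'.2 j : Fin r → Fin q → k)
        = columns (b j) (c j) (α'.1 - (α.1 ∘ₗ β j - γ j ∘ₗ α.1)) := by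
      funext a
      have h3 := congrFun (congrFun hα' j) a
      rw [Pi.add_apply, Pi.add_apply, incidenceMap_apply, incidenceMap_apply, hχ j] at h3
      have h4 : ∑ l, columns (b j) (c j) α.1 a l • x'.2 j l = -γ j (α.1 (b j a)) := by
        rw [← sum_columns_smul (b j) (c j) α.1 a, map_sum, ← Finset.sum_neg_distrib]
        exact Finset.sum_congr rfl fun l _ => by rw [map_smul, ← smul_neg]
      rw [h4] at h3
      rw [columns_apply, ← LinearEquiv.symm_apply_eq, Basis.equivFun_symm_apply]
      simp only [hx', map_neg, Pi.zero_apply] at h3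
      simp only [LinearMap.sub_apply, LinearMap.comp_apply]
      rw [← sub_eq_zero, ← neg_eq_zero, ← h3]
      abel
    rw [hmemE, ← h2, ← hχ j]
    exact h1
  have : Nonempty (Fin s) := ⟨0⟩
  have h := finrank_iInf_of_tangent α.1 E hker htan
  rw [Fintype.card_fin] at h
  rw [hinf, h]
  have hfin : ∀ j, finrank k (E j)
      = finrank k (kernelPreserving (m j) (columns (b j) (c j) α.1)) :=
    fun j => finrank_comap_linearEquiv _ _
  simp only [hfin]

/-- The product of the determinants of tuples of vectors does not vanish generically. -/
lemma exists_polyFun_linearIndependent [FiniteDimensional k V] [FiniteDimensional k Q]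
    (hV : finrank k V = r) (hQ : finrank k Q = q) (s : ℕ) :
    ∃ g ∈ polyFun k ((Fin s → Fin r → V) × (Fin s → Fin q → Q)), (∃ x, g x ≠ 0) ∧
      ∀ x, g x ≠ 0 → (∀ j, LinearIndependent k (x.1 j)) ∧ ∀ j, LinearIndependent k (x.2 j) := by
  set B := finBasisOfFinrankEq k V hV
  set C := finBasisOfFinrankEq k Q hQ
  refine ⟨fun x => (∏ j, (B.toMatrix (x.1 j)).det) * ∏ j, (C.toMatrix (x.2 j)).det,
    mul_mem_polyFun (prod_mem_polyFun _ fun j _ => det_mem_polyFun fun i a => ?_)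
      (prod_mem_polyFun _ fun j _ => det_mem_polyFun fun i a => ?_),
    ⟨(fun _ => B, fun _ => C), by simp⟩, fun x hx => ⟨fun j => ?_, fun j => ?_⟩⟩
  · exact dual_mem_polyFun (B.coord i ∘ₗ LinearMap.proj a ∘ₗ LinearMap.proj j ∘ₗ
      LinearMap.fst k (Fin s → Fin r → V) (Fin s → Fin q → Q))
  · exact dual_mem_polyFun (C.coord i ∘ₗ LinearMap.proj a ∘ₗ LinearMap.proj j ∘ₗ
      LinearMap.snd k (Fin s → Fin r → V) (Fin s → Fin q → Q))
  · refine ((B.is_basis_iff_det).2 (isUnit_iff_ne_zero.2 ?_)).1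
    rw [Basis.det_apply]
    exact Finset.prod_ne_zero_iff.1 (left_ne_zero_of_mul hx) j (Finset.mem_univ j)
  · refine ((C.is_basis_iff_det).2 (isUnit_iff_ne_zero.2 ?_)).1
    rw [Basis.det_apply]
    exact Finset.prod_ne_zero_iff.1 (right_ne_zero_of_mul hx) j (Finset.mem_univ j)

end Conclusion

/-! ### The dimension formula -/

section Numerics

/-- Bookkeeping: the dimension count rewritten in terms of `codimZ`, `eDimZ` and `daggerZ`. -/
lemma eq_codimZ_add_eDimZ_add_daggerZ {n r q d e s h : ℕ} {I : Fin s → Fin r → Fin n}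
    {K : Fin s → Fin d → Fin r} (hq : (q : ℤ) = (n : ℤ) - (r : ℤ)) (he : e + r = q + d)
    {m : Fin s → Fin r → ℕ} (hm : ∀ j a, (m j a : ℤ) = ((I j a : ℕ) : ℤ) - ((a : ℕ) : ℤ))
    {f : Fin s → ℕ} (hf : ∀ j, (f j : ℤ)
      = ∑ a, (m j a : ℤ) + ∑ t, (((K j t : ℕ) : ℤ) - ((t : ℕ) : ℤ) - (m j (K j t) : ℤ)))
    (hcount : h + s * (r * q) + d * e = r * q + ∑ j, f j + s * (d * e)) :
    (h : ℤ) = ((r : ℤ) * ((n : ℤ) - (r : ℤ)) - ∑ j : Fin s, codimZ n r (I j))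
      + eDimZ r d K + daggerZ n r d I K := by
  have he' : (e : ℤ) = (q : ℤ) + d - r := by omega
  have hcount' : (h : ℤ) + s * (r * q) + d * e = r * q + ∑ j, (f j : ℤ) + s * (d * e) := by
    exact_mod_cast hcount
  simp only [hf, hm, Finset.sum_add_distrib, Finset.sum_sub_distrib,
    Finset.sum_const, Finset.card_univ, Fintype.card_fin, nsmul_eq_mul] at hcount'
  simp only [codimZ, eDimZ, daggerZ, ← hq, Finset.sum_add_distrib, Finset.sum_sub_distrib,
    Finset.sum_const, Finset.card_univ, Fintype.card_fin, nsmul_eq_mul]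
  rw [he'] at hcount'
  linear_combination hcount'

variable {n r : ℕ} {i : Fin r → Fin n}

lemma StrictMono.val_add_le (hi : StrictMono i) {a b : Fin r} (t : ℕ) (h : (b : ℕ) = a + t) :
    (i a : ℕ) + t ≤ i b := by
  induction t generalizing b with
  | zero =>
    obtain rfl : b = a := Fin.ext h
    exact le_rfl
  | succ t ih =>
    have h1 := ih (b := ⟨a + t, by omega⟩) rfl
    have h2 : i ⟨a + t, by omega⟩ < i b := hi (Fin.lt_def.2 (by simp only; omega))
    have h3 := Fin.lt_def.1 h2
    omega

lemma StrictMono.val_le_val (hi : StrictMono i) (a : Fin r) : (a : ℕ) ≤ i a := by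
  have := hi.val_add_le (a := ⟨0, a.pos⟩) (b := a) a (Nat.zero_add _).symm
  omega

lemma StrictMono.val_sub_le (hi : StrictMono i) (a : Fin r) : (i a : ℕ) - a ≤ n - r := by
  have h0 := a.isLt
  have h1 := hi.val_add_le (a := a) (b := ⟨r - 1, by omega⟩) (r - 1 - a) (by simp only; omega)
  have h2 := (i ⟨r - 1, by omega⟩).isLt
  omega

lemma StrictMono.monotone_val_sub (hi : StrictMono i) :
    Monotone fun a : Fin r => (i a : ℕ) - (a : ℕ) := by
  intro a b hab
  have h1 := Fin.le_def.1 hab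
  have h2 := hi.val_add_le (a := a) (b := b) (b - a) (by omega)
  simp only
  omega

end Numerics

/-- Proposition `propos`.  For generic `(𝓕,𝓖) ∈ Fl(V)^s × Fl(Q)^s`
and a generic element `φ` of `Hom_𝓘(V,Q,𝓕,𝓖)`, setting `S = ker φ`, `d = dim S`, and
letting `𝓚` be the unique `s`-tuple of subsets of `[r]` of cardinality `d` with
`S ∈ ∩_j Ω°_{K^j}(F^j_•)`, the dimension of `Hom_𝓘(V,Q,𝓕,𝓖)` equals
`[dim Gr(r,n) - ∑_j codim ω_{I^j}] + dim(S,V,𝓕) + [∑_j ∑_{a∈K^j}(n-r+a-i^j_a) - d(n-r)]`. -/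
theorem stmt13 (k : Type) [Field k] [IsAlgClosed k]
    {V Q : Type} [AddCommGroup V] [Module k V] [FiniteDimensional k V]
    [AddCommGroup Q] [Module k Q] [FiniteDimensional k Q]
    (n r s : ℕ) (hs : 0 < s) (hrn : r ≤ n)
    (hV : Module.finrank k V = r) (hQ : Module.finrank k Q = n - r)
    (I : Fin s → Fin r → Fin n) (hI : ∀ j, StrictMono (I j)) :
    GenericFlagPairs k (M := V) (Q := Q) s r (n - r) (fun F G =>
      ∃ U : Set (V →ₗ[k] Q), @IsOpen _ (mZariski k (V →ₗ[k] Q)) U ∧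
        (U ∩ (homSpace I F G : Set (V →ₗ[k] Q))).Nonempty ∧
        ∀ φ ∈ U ∩ (homSpace I F G : Set (V →ₗ[k] Q)),
          ∀ (d : ℕ) (K : Fin s → Fin d → Fin r), (∀ j, StrictMono (K j)) →
            Module.finrank k ↥(LinearMap.ker φ) = d →
            (∀ j, cellMem (K j) (F j) (LinearMap.ker φ)) →
            (Module.finrank k ↥(homSpace I F G) : ℤ)
              = ((r : ℤ) * ((n : ℤ) - (r : ℤ)) - ∑ j : Fin s, codimZ n r (I j))
                + eDimZ r d K + daggerZ n r d I K) := by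
  have hmono := fun j => (hI j).monotone_val_sub
  have hmle := fun j => (hI j).val_sub_le
  set m : Fin s → Fin r → ℕ := fun j a => (I j a : ℕ) - (a : ℕ) with hm
  have : NeZero s := ⟨hs.ne'⟩
  obtain ⟨g, hg, hg₀, hgli⟩ := exists_polyFun_linearIndependent hV hQ s
  obtain ⟨g', hg', ⟨x₀, hx₀⟩, hgen⟩ := exists_generic_kernel (incidenceMap (k := k) m)
    (positionMap k V Q (n - r) m) hg hg₀
  refine ⟨{x | g' x ≠ 0}, isOpen_ne_zero_of_mem_polyFun hg', ⟨x₀, hx₀, hgli _ (hgen _ hx₀).1⟩, ?_⟩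
  rintro ⟨b, c⟩ hx ⟨hb, hc⟩
  obtain ⟨-, α₀, hα₀, hdef⟩ := hgen _ hx
  choose B hB using fun j => exists_basis_of_linearIndependent hV (hb j)
  choose C hC using fun j => exists_basis_of_linearIndependent hQ (hc j)
  obtain rfl : (fun j => ⇑(B j)) = b := funext hB
  obtain rfl : (fun j => ⇑(C j)) = c := funext hC
  have hhom : ∀ {φ : V →ₗ[k] Q},
      φ ∈ homSpace I (fun j => spanFlag k (B j)) (fun j => spanFlag k (C j))
        ↔ ∀ j, columns (B j) (C j) φ ∈ flagTuples k (n - r) (m j) := mem_homSpace_iff hmono B C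
  have hχ₀ := (incidenceMap_eq_zero_iff m B C α₀).1 hα₀
  choose G hG hG₀ hGle using fun i : Fin s × Fin (r + 1) =>
    exists_polyFun_finrank_range_le (IsPolyMap.linear
      (truncatedMap k r (n - r) i.2 ∘ₗ (columns (B i.1) (C i.1)).toLinearMap)) α₀.1
  refine ⟨{φ | ∏ i, G i φ ≠ 0},
    isOpen_ne_zero_of_mem_polyFun (prod_mem_polyFun _ fun i _ => hG i), ⟨α₀.1,
      Finset.prod_ne_zero_iff.2 fun i _ => hG₀ i, hhom.2 fun j => hχ₀ j ▸ (α₀.2 j).2⟩, ?_⟩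
  rintro φ ⟨hφU, hφ⟩ d K hK hd hcell
  have hφ' := hhom.1 hφ
  set α : IncidenceSource k V Q (n - r) m := (φ, fun j => ⟨_, hφ' j⟩) with hα
  have hα0 : incidenceMap m (fun j => ⇑(B j), fun j => ⇑(C j)) α = 0 :=
    (incidenceMap_eq_zero_iff m B C α).2 fun j => rfl
  obtain ⟨hlift, hpos⟩ := hdef α hα0 fun i => by
    rw [positionMap_apply, positionMap_apply, hχ₀]
    exact hGle i φ (Finset.prod_ne_zero_iff.1 hφU i (Finset.mem_univ i))
  have hcount := finrank_iInf_flagTuples m B C α hα0 hlift hpos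
  have hinf : homSpace I (fun j => spanFlag k (B j)) (fun j => spanFlag k (C j))
      = ⨅ j, (flagTuples k (n - r) (m j)).comap (columns (B j) (C j)).toLinearMap := by
    ext ψ
    rw [hhom, Submodule.mem_iInf]
    rfl
  have h1 := α.1.finrank_range_add_finrank_ker
  have h2 := (LinearMap.range α.1).finrank_quotient_add_finrank
  rw [hV, hd] at h1
  rw [hQ] at h2
  rw [← hinf, hV, hQ, hd] at hcount
  refine eq_codimZ_add_eDimZ_add_daggerZ (Nat.cast_sub hrn) (by omega)
    (fun j a => Nat.cast_sub ((hI j).val_le_val a)) (fun j => ?_) hcount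
  refine finrank_kernelPreserving (hmono j) (hmle j) (mem_flagTuples.1 (hφ' j)) (hK j)
    fun u hu => ?_
  rw [← (hcell j).2 u hu, ← map_spanFlag_inf_ker]
  exact LinearEquiv.finrank_map_eq _ _

end
end

section
/- Let V, Q be vector spaces of dimensions r and n−r, 𝓘=(I^1,…,I^s) an s-tuple of subsets of [n] each of cardinality r, 𝓚=(K^1,…,K^s) an s-tuple of subsets of [r] each of cardinality d, and (𝓕,𝓖) ∈ Fl(V)^s × Fl(Q)^s. If ∩_{j=1}^{s} Ω°_{K^j}(F^j_•) ≠ ∅, then dim Hom_𝓘(V,Q,𝓕,𝓖) ≥ [dim(Gr(r,n)) − Σ_{j=1}^{s} codim(ω_{I^j})] + [Σ_{j=1}^{s} Σ_{a∈K^j}(n−r+a−i^j_a) − d(n−r)]. -/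
noncomputable section

open Module Submodule

section FlagLemmas

variable {k V : Type*} [Field k] [AddCommGroup V] [Module k V]

/-- A step of a flag is spanned by the previous one and a vector, which lies in a given
subspace `S` as soon as the trace of the flag on `S` jumps at this step. -/
lemma IsFlag.exists_step [FiniteDimensional k V] {E : ℕ → Submodule k V} (hE : IsFlag E)
    (S : Submodule k V) (m : ℕ) (hm : m < finrank k V) :
    ∃ v ∈ E (m + 1), E (m + 1) ≤ E m ⊔ k ∙ v ∧
      (finrank k ↥(S ⊓ E m) < finrank k ↥(S ⊓ E (m + 1)) → v ∈ S) := by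
  have span_step : ∀ v ∈ E (m + 1), v ∉ E m → E (m + 1) ≤ E m ⊔ k ∙ v := by
    intro v hv hvm
    have hle : E m ⊔ k ∙ v ≤ E (m + 1) :=
      sup_le (hE.1 m.le_succ) ((span_singleton_le_iff_mem v _).2 hv)
    have hlt : E m < E m ⊔ k ∙ v :=
      lt_of_le_of_ne le_sup_left fun h =>
        hvm (h ▸ mem_sup_right (mem_span_singleton_self v))
    have hrank := finrank_lt_finrank_of_lt hlt
    refine (eq_of_le_of_finrank_le hle ?_).ge
    have h1 := hE.2 m
    have h2 := hE.2 (m + 1)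
    omega
  by_cases hjump : finrank k ↥(S ⊓ E m) < finrank k ↥(S ⊓ E (m + 1))
  · have hnle : ¬ S ⊓ E (m + 1) ≤ E m := fun h =>
      absurd (finrank_mono (le_inf inf_le_left h : S ⊓ E (m + 1) ≤ S ⊓ E m)) (not_le.2 hjump)
    obtain ⟨v, hv, hvm⟩ := SetLike.not_le_iff_exists.1 hnle
    exact ⟨v, hv.2, span_step v hv.2 hvm, fun _ => hv.1⟩
  · have hnle : ¬ E (m + 1) ≤ E m := fun h => by
      have h0 := finrank_mono h
      have h1 := hE.2 m
      have h2 := hE.2 (m + 1)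
      omega
    obtain ⟨v, hv, hvm⟩ := SetLike.not_le_iff_exists.1 hnle
    exact ⟨v, hv, span_step v hv hvm, fun h => absurd h hjump⟩

/-- The trace of a flag on a point of the Schubert cell of `K` jumps at the elements of `K`. -/
lemma cellMem.finrank_inf_lt {r d : ℕ} {K : Fin d → Fin r} {E : ℕ → Submodule k V}
    {S : Submodule k V} (hS : cellMem K E S) (t : Fin d) :
    finrank k ↥(S ⊓ E (K t : ℕ)) < finrank k ↥(S ⊓ E ((K t : ℕ) + 1)) := by
  rw [hS.2 _ (K t).2.le, hS.2 _ (K t).2]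
  refine Finset.card_lt_card (Finset.ssubset_iff_of_subset ?_ |>.2 ⟨t, by simp, by simp⟩)
  intro a ha
  simp only [Finset.mem_filter, Finset.mem_univ, true_and] at ha ⊢
  omega

end FlagLemmas

lemma mem_homConstraint_s14 {k M Q : Type*} [Field k] [AddCommGroup M] [Module k M]
    [AddCommGroup Q] [Module k Q] {p : Submodule k M} {q : Submodule k Q} {φ : M →ₗ[k] Q} :
    φ ∈ homConstraint p q ↔ p ≤ q.comap φ := by
  rw [homConstraint, LinearMap.mem_ker, LinearMap.ext_iff]
  simp [SetLike.le_def]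

/-- The dimension of the common kernel of finitely many linear maps to finite-dimensional
spaces is at least the expected one. -/
lemma finrank_le_finrank_ker_pi_add {k W ι : Type*} [Field k] [AddCommGroup W] [Module k W]
    [FiniteDimensional k W] [Fintype ι] {N : ι → Type*} [∀ i, AddCommGroup (N i)]
    [∀ i, Module k (N i)] [∀ i, FiniteDimensional k (N i)] (f : ∀ i, W →ₗ[k] N i) :
    finrank k W ≤ finrank k ↥(LinearMap.ker (LinearMap.pi f)) + ∑ i, finrank k (N i) := by
  rw [← LinearMap.finrank_range_add_finrank_ker (LinearMap.pi f), add_comm,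
    ← Module.finrank_pi_fintype k]
  exact Nat.add_le_add_left (finrank_le _) _

/-- A sum over the complement of the image of an injective map. -/
lemma sum_ite_mem_range {ι κ : Type*} [Fintype ι] [Fintype κ] {K : κ → ι}
    (hK : Function.Injective K) (x : ι → ℤ) [DecidablePred (· ∈ Set.range K)] :
    ∑ a, (if a ∈ Set.range K then 0 else x a) = ∑ a, x a - ∑ t, x (K t) := by
  classical
  have h : ∑ t, x (K t) = ∑ a, (if a ∈ Set.range K then x a else 0) := by
    rw [← Finset.sum_filter, ← Finset.sum_image (f := x) fun a _ b _ h => hK h]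
    refine Finset.sum_congr ?_ fun _ _ => rfl
    ext a
    simp
  rw [h, ← Finset.sum_sub_distrib]
  refine Finset.sum_congr rfl fun a _ => ?_
  split_ifs <;> simp

/-- A strictly increasing tuple grows at least as fast as its index. -/
lemma Fin.strictMono_add_sub_le {n r : ℕ} {i : Fin r → Fin n} (hi : StrictMono i) {a b : Fin r}
    (hab : a ≤ b) : (i a : ℕ) + (b - a : ℕ) ≤ i b := by
  obtain ⟨b, hb⟩ := b
  induction b with
  | zero =>
    obtain rfl : a = ⟨0, hb⟩ := le_antisymm hab (Nat.zero_le _)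
    simp
  | succ b ih =>
    rcases hab.eq_or_lt with rfl | hlt
    · simp
    · have hle : a ≤ ⟨b, by omega⟩ := by
        rw [Fin.lt_def] at hlt; rw [Fin.le_def]; simp only at hlt ⊢; omega
      have h1 := ih (by omega) hle
      have h2 : i ⟨b, by omega⟩ < i ⟨b + 1, hb⟩ := hi (by simp [Fin.lt_def])
      rw [Fin.lt_def] at h2
      rw [Fin.le_def] at hle
      simp only at h1 hle ⊢
      omega

lemma Fin.strictMono_le_and_add_le {n r : ℕ} {i : Fin r → Fin n} (hi : StrictMono i) (a : Fin r) :
    (a : ℕ) ≤ i a ∧ (i a : ℕ) + r ≤ n + a := by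
  have hr : 0 < r := a.pos
  have h0 := Fin.strictMono_add_sub_le hi (a := ⟨0, hr⟩) (b := a) (Nat.zero_le _)
  have h1 := Fin.strictMono_add_sub_le hi (a := a) (b := ⟨r - 1, by omega⟩)
    (by rw [Fin.le_def]; simp only; omega)
  have h2 := (i ⟨r - 1, by omega⟩).2
  simp only at h0 h1
  omega

/-- Proposition `strong` (1).  If `∩_j Ω°_{K^j}(F^j_•) ≠ ∅` (in
`Gr(d,V)`), then for any `(𝓕,𝓖)`,
`dim Hom_𝓘(V,Q,𝓕,𝓖) ≥ [dim Gr(r,n) - ∑_j codim ω_{I^j}] + [∑_j ∑_{a∈K^j}(n-r+a-i^j_a) - d(n-r)]`. -/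
theorem stmt14 (k : Type) [Field k] [IsAlgClosed k]
    {V Q : Type} [AddCommGroup V] [Module k V] [FiniteDimensional k V]
    [AddCommGroup Q] [Module k Q] [FiniteDimensional k Q]
    (n r d s : ℕ) (hs : 0 < s) (hrn : r ≤ n)
    (hV : Module.finrank k V = r) (hQ : Module.finrank k Q = n - r)
    (I : Fin s → Fin r → Fin n) (hI : ∀ j, StrictMono (I j))
    (K : Fin s → Fin d → Fin r) (hK : ∀ j, StrictMono (K j))
    (F : Fin s → ℕ → Submodule k V) (hF : ∀ j, IsFlag (F j))
    (G : Fin s → ℕ → Submodule k Q) (hG : ∀ j, IsFlag (G j))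
    (hne : ∃ S : Submodule k V, Module.finrank k ↥S = d ∧ ∀ j, cellMem (K j) (F j) S) :
    ((r : ℤ) * ((n : ℤ) - (r : ℤ)) - ∑ j : Fin s, codimZ n r (I j)) + daggerZ n r d I K
      ≤ (Module.finrank k ↥(homSpace I F G) : ℤ) := by
  classical
  obtain ⟨S, hSd, hS⟩ := hne
  choose v hv hstep hvS using fun (j : Fin s) (a : Fin r) =>
    (hF j).exists_step S (a : ℕ) (hV ▸ a.2)
  let H : Fin s × Fin r → Submodule k Q := fun p =>
    if p.2 ∈ Set.range (K p.1) then ⊤ else G p.1 ((I p.1 p.2 : ℕ) - (p.2 : ℕ))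
  let f : ∀ p : Fin s × Fin r, ((V ⧸ S) →ₗ[k] Q) →ₗ[k] Q ⧸ H p := fun p =>
    (H p).mkQ ∘ₗ LinearMap.applyₗ (S.mkQ (v p.1 p.2))
  have hvanish : ∀ ψ ∈ LinearMap.ker (LinearMap.pi f), ψ ∘ₗ S.mkQ ∈ homSpace I F G := by
    intro ψ hψ
    have hgen : ∀ (j : Fin s) (a : Fin r),
        ψ (S.mkQ (v j a)) ∈ G j ((I j a : ℕ) - (a : ℕ)) := by
      intro j a
      by_cases ha : a ∈ Set.range (K j)
      · obtain ⟨t, rfl⟩ := ha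
        have : S.mkQ (v j (K j t)) = 0 := by
          simpa using hvS j (K j t) ((hS j).finrank_inf_lt t)
        rw [this, map_zero]
        exact zero_mem _
      · have h := congrFun (LinearMap.mem_ker.1 hψ) (j, a)
        simpa [f, H, ha] using h
    simp only [homSpace, mem_iInf, mem_homConstraint_s14]
    intro j a
    have key : ∀ m ≤ (a : ℕ) + 1,
        F j m ≤ (G j ((I j a : ℕ) - (a : ℕ))).comap (ψ ∘ₗ S.mkQ) := by
      intro m
      induction m with
      | zero =>
        intro _
        have h0 : F j 0 = ⊥ := finrank_eq_zero.1 (by simpa using (hF j).2 0)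
        rw [h0]
        exact bot_le
      | succ m ih =>
        intro hm
        have hma : m < r := by omega
        refine (hstep j ⟨m, hma⟩).trans (sup_le (ih (by omega)) ?_)
        rw [span_singleton_le_iff_mem]
        refine (hG j).1 ?_ (hgen j ⟨m, hma⟩)
        have := Fin.strictMono_add_sub_le (hI j) (a := ⟨m, hma⟩) (b := a)
          (by rw [Fin.le_def]; simp only; omega)
        simp only at this ⊢
        omega
    exact key _ le_rfl
  have hle : finrank k ↥(LinearMap.ker (LinearMap.pi f)) ≤ finrank k ↥(homSpace I F G) := by
    have hinj : Function.Injective (LinearMap.lcomp k Q S.mkQ) := fun ψ₁ ψ₂ h =>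
      (LinearMap.cancel_right S.mkQ_surjective).1 h
    rw [(equivMapOfInjective _ hinj _).finrank_eq]
    refine finrank_mono ?_
    rintro _ ⟨ψ, hψ, rfl⟩
    exact hvanish ψ hψ
  have hrank := finrank_le_finrank_ker_pi_add f
  have hW : (finrank k ((V ⧸ S) →ₗ[k] Q) : ℤ) = ((r : ℤ) - d) * ((n : ℤ) - r) := by
    have h := S.finrank_quotient_add_finrank
    rw [finrank_linearMap, hQ, Nat.cast_mul, Nat.cast_sub hrn]
    congr 1
    omega
  have hH : ∀ p : Fin s × Fin r, (finrank k (Q ⧸ H p) : ℤ) =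
      if p.2 ∈ Set.range (K p.1) then 0
      else (n : ℤ) - r + ((p.2 : ℕ) : ℤ) - ((I p.1 p.2 : ℕ) : ℤ) := by
    rintro ⟨j, a⟩
    have h := (H (j, a)).finrank_quotient_add_finrank
    by_cases ha : a ∈ Set.range (K j)
    · have hrank : finrank k ↥(H (j, a)) = finrank k Q := by
        rw [show H (j, a) = ⊤ from if_pos ha, finrank_top]
      rw [if_pos ha]
      omega
    · have hrank : finrank k ↥(H (j, a)) = min ((I j a : ℕ) - (a : ℕ)) (finrank k Q) := by
        rw [show H (j, a) = G j _ from if_neg ha, (hG j).2]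
      have := Fin.strictMono_le_and_add_le (hI j) a
      rw [if_neg ha]
      dsimp only
      omega
  have hsum : ((∑ p, finrank k (Q ⧸ H p) : ℕ) : ℤ) = ∑ j, codimZ n r (I j) -
      ∑ j : Fin s, ∑ t : Fin d,
        ((n : ℤ) - r + ((K j t : ℕ) : ℤ) - ((I j (K j t) : ℕ) : ℤ)) := by
    rw [Nat.cast_sum, Finset.sum_congr rfl fun p _ => hH p, Fintype.sum_prod_type,
      ← Finset.sum_sub_distrib]
    exact Finset.sum_congr rfl fun j _ => sum_ite_mem_range (hK j).injective _
  rw [daggerZ]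
  have h1 : ((r : ℤ) - d) * ((n : ℤ) - r) ≤
      finrank k ↥(homSpace I F G) + (∑ p, finrank k (Q ⧸ H p) : ℕ) := by
    rw [← hW]
    exact_mod_cast hrank.trans (Nat.add_le_add_right hle _)
  rw [hsum] at h1
  linarith

end
end
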